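/- Let n ≥ 2, let A ∈ M̂_{m×n} be nonzero, let j ∈ {0,1,…,n−1}, and suppose Ã := f̃^t_j A ≠ 0, so that Ã = A − Ê_{u,j} + Ê_{u,j+1} for the selected row u. Let s = d^{sw}_A(u,j) and let z_s be the zig-zag at level s associated to d^{sw}_A. Then the southwest channel numbering d^{sw}_{Ã} of Ã is the unique proper numbering d⁻ on Ã such that d⁻(c) = d^{sw}_A(c) for all c ∈ supp(A) ∩ supp(Ã), and d⁻(u, j+1) equals d^{sw}_A(u,j) if u is the minimal row index i with (i,j) ∈ z_s, and equals d^{sw}_A(u,j) + 1 otherwise. -/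

import Mathlib

open scoped Classical

namespace AffineRSK

/-- `ℤ × ℤ`-matrices with non-negative integer entries. -/
abbrev Mat : Type := ℤ → ℤ → ℕ

abbrev Cell : Type := ℤ × ℤ

/-- Generalized affine permutations of period `(m, n)`:
`a_{i+m, j+n} = a_{ij}` and each column has finite support. -/
def IsGAP (m n : ℕ) (A : Mat) : Prop :=
  (∀ i j : ℤ, A (i + m) (j + n) = A i j) ∧ ∀ j : ℤ, {i : ℤ | A i j ≠ 0}.Finite

/-- Generalized dual affine permutations: entries in `{0, 1}`. -/
def IsGDAP (m n : ℕ) (A : Mat) : Prop :=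
  IsGAP m n A ∧ ∀ i j : ℤ, A i j ≤ 1

def supp (A : Mat) : Set Cell := {c : Cell | A c.1 c.2 ≠ 0}

def tauC (m n : ℕ) (c : Cell) : Cell := (c.1 + (m : ℤ), c.2 + (n : ℤ))

/-- `NW c₁ c₂` means `c₁ >_NW c₂`. -/
def NW (c₁ c₂ : Cell) : Prop := c₁.1 < c₂.1 ∧ c₁.2 < c₂.2

/-- `nwGe c₁ c₂` means `c₁ ≥_nw c₂`. -/
def nwGe (c₁ c₂ : Cell) : Prop := c₁.1 ≤ c₂.1 ∧ c₁.2 ≤ c₂.2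

/-- `neLe c₁ c₂` means `c₁ ≤_ne c₂`. -/
def neLe (c₁ c₂ : Cell) : Prop := c₂.1 ≤ c₁.1 ∧ c₁.2 ≤ c₂.2

/-- `nWgt c₁ c₂` means `c₁ >_nW c₂` (dual order). -/
def nWgt (c₁ c₂ : Cell) : Prop := c₁.1 ≤ c₂.1 ∧ c₁.2 < c₂.2

/-- `NeLt c₁ c₂` means `c₁ <_Ne c₂` (dual order). -/
def NeLt (c₁ c₂ : Cell) : Prop := c₂.1 < c₁.1 ∧ c₁.2 ≤ c₂.2

/-- A proper numbering on `A`. -/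
def IsProper (A : Mat) (d : Cell → ℤ) : Prop :=
  (∀ c₁ ∈ supp A, ∀ c₂ ∈ supp A, NW c₂ c₁ → d c₂ < d c₁) ∧
    ∀ c₁ ∈ supp A, ∃ c₂ ∈ supp A, NW c₂ c₁ ∧ d c₂ = d c₁ - 1

/-- A dual proper numbering on `A`. -/
def IsProper' (A : Mat) (d : Cell → ℤ) : Prop :=
  (∀ c₁ ∈ supp A, ∀ c₂ ∈ supp A, nWgt c₂ c₁ → d c₂ < d c₁) ∧
    ∀ c₁ ∈ supp A, ∃ c₂ ∈ supp A, nWgt c₂ c₁ ∧ d c₂ = d c₁ - 1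

/-- An enumeration of a stream of flow `l`. -/
def IsStreamEnum (m n : ℕ) (e : ℤ → Cell) (l : ℕ) : Prop :=
  0 < l ∧ (∀ i : ℤ, NW (e i) (e (i + 1))) ∧ ∀ i : ℤ, tauC m n (e i) = e (i + l)

def IsStreamEnum' (m n : ℕ) (e : ℤ → Cell) (l : ℕ) : Prop :=
  0 < l ∧ (∀ i : ℤ, nWgt (e i) (e (i + 1))) ∧ ∀ i : ℤ, tauC m n (e i) = e (i + l)

def IsStream (m n : ℕ) (S : Set Cell) (l : ℕ) : Prop :=
  ∃ e : ℤ → Cell, IsStreamEnum m n e l ∧ Set.range e = S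

def IsStream' (m n : ℕ) (S : Set Cell) (l : ℕ) : Prop :=
  ∃ e : ℤ → Cell, IsStreamEnum' m n e l ∧ Set.range e = S

/-- A channel of `A`: a stream contained in `supp A` of maximal flow. -/
def IsChannel (m n : ℕ) (A : Mat) (C : Set Cell) : Prop :=
  ∃ l : ℕ, IsStream m n C l ∧ C ⊆ supp A ∧
    ∀ (S : Set Cell) (l' : ℕ), IsStream m n S l' → S ⊆ supp A → l' ≤ l

def IsChannel' (m n : ℕ) (A : Mat) (C : Set Cell) : Prop :=
  ∃ l : ℕ, IsStream' m n C l ∧ C ⊆ supp A ∧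
    ∀ (S : Set Cell) (l' : ℕ), IsStream' m n S l' → S ⊆ supp A → l' ≤ l

def Csw (A : Mat) (C : Set Cell) : Set Cell :=
  {c ∈ supp A | ∃ c' ∈ C, neLe c c'}

def Csw' (A : Mat) (C : Set Cell) : Set Cell :=
  {c ∈ supp A | c ∈ C ∨ ∃ c' ∈ C, NeLt c c'}

/-- `swGe A C₁ C₂` means `C₁ ≽_sw C₂`. -/
def swGe (A : Mat) (C₁ C₂ : Set Cell) : Prop := C₁ ⊆ Csw A C₂

def swGe' (A : Mat) (C₁ C₂ : Set Cell) : Prop := C₁ ⊆ Csw' A C₂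

/-- The set of values `d₀(c'_k) + k` over `>_NW`-chains from `c` to the channel
enumerated by `e` (where `d₀ (e idx) = idx`). -/
def chainSet (A : Mat) (e : ℤ → Cell) (c : Cell) : Set ℤ :=
  {v : ℤ | ∃ (k : ℕ) (ch : ℕ → Cell),
      ch 0 = c ∧ (∀ i ≤ k, ch i ∈ supp A) ∧ (∀ i < k, NW (ch (i + 1)) (ch i)) ∧
        ∃ idx : ℤ, e idx = ch k ∧ v = idx + (k : ℤ)}

def chainSet' (A : Mat) (e : ℤ → Cell) (c : Cell) : Set ℤ :=
  {v : ℤ | ∃ (k : ℕ) (ch : ℕ → Cell),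
      ch 0 = c ∧ (∀ i ≤ k, ch i ∈ supp A) ∧ (∀ i < k, nWgt (ch (i + 1)) (ch i)) ∧
        ∃ idx : ℤ, e idx = ch k ∧ v = idx + (k : ℤ)}

/-- `d` is the channel numbering `d^C_A` for the channel enumerated by `e`. -/
def IsChannelNumbering (A : Mat) (e : ℤ → Cell) (d : Cell → ℤ) : Prop :=
  ∀ c ∈ supp A, IsGreatest (chainSet A e c) (d c)

def IsChannelNumbering' (A : Mat) (e : ℤ → Cell) (d : Cell → ℤ) : Prop :=
  ∀ c ∈ supp A, IsGreatest (chainSet' A e c) (d c)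

/-- `e` enumerates the southwest channel of `A`. -/
def IsSWChannelEnum (m n : ℕ) (A : Mat) (e : ℤ → Cell) : Prop :=
  (∃ l : ℕ, IsStreamEnum m n e l) ∧ IsChannel m n A (Set.range e) ∧
    ∀ C : Set Cell, IsChannel m n A C → swGe A (Set.range e) C

def IsSWChannelEnum' (m n : ℕ) (A : Mat) (e : ℤ → Cell) : Prop :=
  (∃ l : ℕ, IsStreamEnum' m n e l) ∧ IsChannel' m n A (Set.range e) ∧
    ∀ C : Set Cell, IsChannel' m n A C → swGe' A (Set.range e) C

/-- `d` is a southwest channel numbering of `A`. -/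
def IsSWNumbering (m n : ℕ) (A : Mat) (d : Cell → ℤ) : Prop :=
  ∃ e : ℤ → Cell, IsSWChannelEnum m n A e ∧ IsChannelNumbering A e d

def IsSWNumbering' (m n : ℕ) (A : Mat) (d : Cell → ℤ) : Prop :=
  ∃ e : ℤ → Cell, IsSWChannelEnum' m n A e ∧ IsChannelNumbering' A e d

/-- A zig-zag: bi-infinite east/north lattice path, eventually east on the
right and coming from the south on the left. -/
def IsZigZag (z : ℤ → Cell) : Prop :=
  (∀ i : ℤ, z (i + 1) = ((z i).1, (z i).2 + 1) ∨ z (i + 1) = ((z i).1 - 1, (z i).2)) ∧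
  (∃ N : ℤ, ∀ i : ℤ, N ≤ i → z (i + 1) = ((z i).1, (z i).2 + 1)) ∧
    ∃ N : ℤ, ∀ i : ℤ, i ≤ N → z (i + 1) = ((z i).1 - 1, (z i).2)

def innerCorners (z : ℤ → Cell) : Set Cell :=
  {c : Cell | ∃ i : ℤ, z i = c ∧ z i = ((z (i - 1)).1 - 1, (z (i - 1)).2) ∧
      z (i + 1) = ((z i).1, (z i).2 + 1)}

def outerCorners (z : ℤ → Cell) : Set Cell :=
  {c : Cell | ∃ i : ℤ, z i = c ∧ z i = ((z (i - 1)).1, (z (i - 1)).2 + 1) ∧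
      z (i + 1) = ((z i).1 - 1, (z i).2)}

def levelSet (A : Mat) (d : Cell → ℤ) (k : ℤ) : Set Cell := {c ∈ supp A | d c = k}

/-- `≥_nw`-maximal cells of `S`. -/
def nwMaximal (S : Set Cell) : Set Cell := {c ∈ S | ∀ c' ∈ S, nwGe c' c → c' = c}

/-- `>_nW`-maximal cells of `S` (dual). -/
def nWMaximal (S : Set Cell) : Set Cell := {c ∈ S | ∀ c' ∈ S, ¬ nWgt c' c}

/-- `z` is the zig-zag at level `k` associated to the numbering `d`. -/
def ZigZagAt (A : Mat) (d : Cell → ℤ) (k : ℤ) (z : ℤ → Cell) : Prop :=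
  IsZigZag z ∧ innerCorners z = nwMaximal (levelSet A d k)

def ZigZagAt' (A : Mat) (d : Cell → ℤ) (k : ℤ) (z : ℤ → Cell) : Prop :=
  IsZigZag z ∧ innerCorners z = nWMaximal (levelSet A d k)

def IsInnerOf (A : Mat) (d : Cell → ℤ) (c : Cell) : Prop :=
  ∃ (k : ℤ) (z : ℤ → Cell), ZigZagAt A d k z ∧ c ∈ innerCorners z

def IsOuterOf (A : Mat) (d : Cell → ℤ) (c : Cell) : Prop :=
  ∃ (k : ℤ) (z : ℤ → Cell), ZigZagAt A d k z ∧ c ∈ outerCorners z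

def IsInnerOf' (A : Mat) (d : Cell → ℤ) (c : Cell) : Prop :=
  ∃ (k : ℤ) (z : ℤ → Cell), ZigZagAt' A d k z ∧ c ∈ innerCorners z

def IsOuterOf' (A : Mat) (d : Cell → ℤ) (c : Cell) : Prop :=
  ∃ (k : ℤ) (z : ℤ → Cell), ZigZagAt' A d k z ∧ c ∈ outerCorners z

/-- `B` is obtained from `A` by subtracting `1` at inner corners and adding `1`
at outer corners. -/
def FlatEntries (A B : Mat) (Inn Out : Cell → Prop) : Prop :=
  ∀ c : Cell,
    (Inn c → B c.1 c.2 + 1 = A c.1 c.2) ∧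
    (Out c → B c.1 c.2 = A c.1 c.2 + 1) ∧
    (¬ Inn c → ¬ Out c → B c.1 c.2 = A c.1 c.2)

/-- `B = A^♭`. -/
def FlatRel (m n : ℕ) (A B : Mat) : Prop :=
  ∃ d : Cell → ℤ, IsSWNumbering m n A d ∧
    FlatEntries A B (IsInnerOf A d) (IsOuterOf A d)

/-- `B = A^{♭'}` (dual). -/
def FlatRel' (m n : ℕ) (A B : Mat) : Prop :=
  ∃ d : Cell → ℤ, IsSWNumbering' m n A d ∧
    FlatEntries A B (IsInnerOf' A d) (IsOuterOf' A d)

/-- `c` is the back-post corner of the zig-zag `z`: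
`(row of rightmost inner corner, column of leftmost inner corner)`. -/
def IsBackPost (z : ℤ → Cell) (c : Cell) : Prop :=
  ∃ cr ∈ innerCorners z, ∃ cl ∈ innerCorners z,
    (∀ c' ∈ innerCorners z, c'.2 ≤ cr.2) ∧ (∀ c' ∈ innerCorners z, cl.2 ≤ c'.2) ∧
      c = (cr.1, cl.2)

def backPostSet (A : Mat) (d : Cell → ℤ) : Set Cell :=
  {c : Cell | ∃ (k : ℤ) (z : ℤ → Cell), ZigZagAt A d k z ∧ IsBackPost z c}

def backPostSet' (A : Mat) (d : Cell → ℤ) : Set Cell :=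
  {c : Cell | ∃ (k : ℤ) (z : ℤ → Cell), ZigZagAt' A d k z ∧ IsBackPost z c}

/-- Defining data `(a, b, r)` of the stream enumerated by `e` of flow `l`. -/
def StreamData (m n : ℕ) (e : ℤ → Cell) (l : ℕ) (a b : ℕ → ℤ) (r : ℤ) : Prop :=
  ∃ r₁ r₂ : ℤ,
    (∀ p : ℕ, p < l → a p = (e (r₁ + 1 + p)).1 ∧ 1 ≤ a p ∧ a p ≤ (m : ℤ)) ∧
    (∀ p : ℕ, p < l → b p = (e (r₂ + 1 + p)).2 ∧ 1 ≤ b p ∧ b p ≤ (n : ℤ)) ∧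
      r = r₁ - r₂

/-- The matrix-ball iteration `A = A^(0), A^(t) = (A^(t-1))^♭`, with
`A^(t) ≠ O` for `t < s` and `A^(s) = O`. -/
def MBCseq (m n : ℕ) (A : Mat) (s : ℕ) (Aseq : ℕ → Mat) : Prop :=
  Aseq 0 = A ∧ (∀ t < s, Aseq t ≠ 0) ∧ Aseq s = 0 ∧
    ∀ t < s, FlatRel m n (Aseq t) (Aseq (t + 1))

def MBCseq' (m n : ℕ) (A : Mat) (s : ℕ) (Aseq : ℕ → Mat) : Prop :=
  Aseq 0 = A ∧ (∀ t < s, Aseq t ≠ 0) ∧ Aseq s = 0 ∧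
    ∀ t < s, FlatRel' m n (Aseq t) (Aseq (t + 1))

/-- `κ₀(A) = (P, Q, ρ)`, with shape given by the column lengths `μ`:
the `t`-th columns (from the left, `0`-based) of `P` and `Q` are the defining
data of the stream of back-post corners of the zig-zags of `d^{sw}_{A^(t)}`. -/
def Kappa0Rel (m n : ℕ) (A : Mat) (s : ℕ) (μ : ℕ → ℕ) (P Q : ℕ → ℕ → ℤ)
    (ρ : ℕ → ℤ) : Prop :=
  ∃ Aseq : ℕ → Mat, MBCseq m n A s Aseq ∧
    ∀ t < s, ∃ (d : Cell → ℤ) (e : ℤ → Cell),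
      IsSWNumbering m n (Aseq t) d ∧ IsStreamEnum m n e (μ t) ∧
        Set.range e = backPostSet (Aseq t) d ∧
        StreamData m n e (μ t) (fun x => P x t) (fun x => Q x t) (ρ t)

def Kappa0Rel' (m n : ℕ) (A : Mat) (s : ℕ) (μ : ℕ → ℕ) (P Q : ℕ → ℕ → ℤ)
    (ρ : ℕ → ℤ) : Prop :=
  ∃ Aseq : ℕ → Mat, MBCseq' m n A s Aseq ∧
    ∀ t < s, ∃ (d : Cell → ℤ) (e : ℤ → Cell),
      IsSWNumbering' m n (Aseq t) d ∧ IsStreamEnum' m n e (μ t) ∧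
        Set.range e = backPostSet' (Aseq t) d ∧
        StreamData m n e (μ t) (fun x => P x t) (fun x => Q x t) (ρ t)

/-! ### Columns and the shift `τ` -/

/-- Extension of a column `c` of length `b` to `ℤ`: `c̃(x + bq) = c(x) + nq`. -/
def colExt (n b : ℕ) (c : ℕ → ℤ) (z : ℤ) : ℤ :=
  c (Int.toNat (Int.emod z (b : ℤ))) + (n : ℤ) * Int.ediv z (b : ℤ)

/-- `τ_n^k` applied to a column of length `b`. -/
def tauPow (n b : ℕ) (k : ℤ) (c : ℕ → ℤ) : ℕ → ℤ :=
  fun x => colExt n b c ((x : ℤ) + k)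

/-- The two-column tableau `(column t of T, τ_N^r(column (t+1) of T))`
(both of height `μ t`) is `ℤ`-semistandard. -/
def pairCond (N : ℕ) (μ : ℕ → ℕ) (T : ℕ → ℕ → ℤ) (t : ℕ) (r : ℕ) : Prop :=
  (∀ x : ℕ, x + 1 < μ t → T x t < T (x + 1) t) ∧
  (∀ x : ℕ, x + 1 < μ t →
    tauPow N (μ t) (r : ℤ) (fun y => T y (t + 1)) x <
      tauPow N (μ t) (r : ℤ) (fun y => T y (t + 1)) (x + 1)) ∧
    ∀ x < μ t, T x t ≤ tauPow N (μ t) (r : ℤ) (fun y => T y (t + 1)) x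

/-- The offset `r` for the adjacent pair of columns `(t, t+1)`. -/
noncomputable def rOff (N : ℕ) (μ : ℕ → ℕ) (T : ℕ → ℕ → ℤ) (t : ℕ) : ℕ :=
  sInf {r : ℕ | pairCond N μ T t r}

/-- Dual version: placing row `t` above row `τ_N^r(row (t+1))` (rows of the
transposed tableau, i.e. columns of `T`) is `ℤ`-semistandard. -/
def dualPairCond (N : ℕ) (μ : ℕ → ℕ) (T : ℕ → ℕ → ℤ) (t : ℕ) (r : ℕ) : Prop :=
  (∀ x : ℕ, x + 1 < μ t → T x t ≤ T (x + 1) t) ∧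
  (∀ x : ℕ, x + 1 < μ t →
    tauPow N (μ t) (r : ℤ) (fun y => T y (t + 1)) x ≤
      tauPow N (μ t) (r : ℤ) (fun y => T y (t + 1)) (x + 1)) ∧
    ∀ x < μ t, T x t < tauPow N (μ t) (r : ℤ) (fun y => T y (t + 1)) x

noncomputable def rOffDual (N : ℕ) (μ : ℕ → ℕ) (T : ℕ → ℕ → ℤ) (t : ℕ) : ℕ :=
  sInf {r : ℕ | dualPairCond N μ T t r}

/-- First column of the rectangle block containing column `t`. -/
noncomputable def blockStart (μ : ℕ → ℕ) (t : ℕ) : ℕ := sInf {t' : ℕ | μ t' = μ t}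

/-- The symmetrized offset entry attached to column `t`
(`η_j` where `j` is the position of `t` from the right in its block). -/
noncomputable def etaCol (N : ℕ) (μ : ℕ → ℕ) (T : ℕ → ℕ → ℤ) (t : ℕ) : ℕ :=
  ∑ u ∈ Finset.Ico (blockStart μ t) t, rOff N μ T u

noncomputable def etaColDual (N : ℕ) (μ : ℕ → ℕ) (T : ℕ → ℕ → ℤ) (t : ℕ) : ℕ :=
  ∑ u ∈ Finset.Ico (blockStart μ t) t, rOffDual N μ T u

/-- Entries outside the shape are normalized to `0`. -/
def PadZeroT (s : ℕ) (μ : ℕ → ℕ) (T : ℕ → ℕ → ℤ) : Prop :=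
  ∀ x t : ℕ, s ≤ t ∨ μ t ≤ x → T x t = 0

/-- `μ` encodes (the conjugate of) a partition `λ ∈ 𝒫_m ∩ 𝒫_n` with `s` columns. -/
def ShapeOK (m n s : ℕ) (μ : ℕ → ℕ) : Prop :=
  (∀ t : ℕ, t + 1 < s → μ (t + 1) ≤ μ t) ∧ (∀ t < s, 0 < μ t ∧ μ t ≤ m ∧ μ t ≤ n) ∧
    ∀ t : ℕ, s ≤ t → μ t = 0

/-- Dual shape condition: `λ ∈ 𝒫_n`. -/
def ShapeOK' (n s : ℕ) (μ : ℕ → ℕ) : Prop :=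
  (∀ t : ℕ, t + 1 < s → μ (t + 1) ≤ μ t) ∧ (∀ t < s, 0 < μ t ∧ μ t ≤ n) ∧
    ∀ t : ℕ, s ≤ t → μ t = 0

/-- `κ(A) = (P, Q)` where `Q` is obtained by shifting the `t`-th column of `Q₀`
by `τ_n^{ρ_t + η_t}` (`η` the symmetrized offset vector of `P₀`). -/
def KappaRel (m n : ℕ) (A : Mat) (s : ℕ) (μ : ℕ → ℕ) (P Q : ℕ → ℕ → ℤ) : Prop :=
  ∃ (P' Q' : ℕ → ℕ → ℤ) (ρ : ℕ → ℤ),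
    Kappa0Rel m n A s μ P' Q' ρ ∧
    (∀ t < s, ∀ x < μ t,
      P x t = P' x t ∧
        Q x t = tauPow n (μ t) (ρ t + (etaCol m μ P' t : ℤ)) (fun y => Q' y t) x) ∧
    PadZeroT s μ P ∧ PadZeroT s μ Q ∧ ∀ t : ℕ, s ≤ t → μ t = 0

def KappaRel' (m n : ℕ) (A : Mat) (s : ℕ) (μ : ℕ → ℕ) (P Q : ℕ → ℕ → ℤ) : Prop :=
  ∃ (P' Q' : ℕ → ℕ → ℤ) (ρ : ℕ → ℤ),
    Kappa0Rel' m n A s μ P' Q' ρ ∧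
    (∀ t < s, ∀ x < μ t,
      P x t = P' x t ∧
        Q x t = tauPow n (μ t) (ρ t + (etaColDual m μ P' t : ℤ)) (fun y => Q' y t) x) ∧
    PadZeroT s μ P ∧ PadZeroT s μ Q ∧ ∀ t : ℕ, s ≤ t → μ t = 0

/-- Membership in `⨆_{λ ∈ 𝒫_m ∩ 𝒫_n} CSST_[m](λ) × B_n(λ)`:
`P` is column semistandard with entries in `{1, …, m}` and `Q` is a
`ℤ`-semistandard filling whose columns span less than `n` and whose rows
weakly increase within each rectangle block. -/
def InTargetRSK (m n s : ℕ) (μ : ℕ → ℕ) (P Q : ℕ → ℕ → ℤ) : Prop :=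
  ShapeOK m n s μ ∧ PadZeroT s μ P ∧ PadZeroT s μ Q ∧
  (∀ t < s, ∀ x : ℕ, x + 1 < μ t → P x t < P (x + 1) t) ∧
  (∀ t < s, ∀ x < μ t, 1 ≤ P x t ∧ P x t ≤ (m : ℤ)) ∧
  (∀ t < s, ∀ x : ℕ, x + 1 < μ t → Q x t < Q (x + 1) t) ∧
  (∀ t < s, Q (μ t - 1) t - Q 0 t < (n : ℤ)) ∧
    ∀ t : ℕ, t + 1 < s → μ t = μ (t + 1) → ∀ x < μ t, Q x t ≤ Q x (t + 1)

/-- Membership in `⨆_{λ ∈ 𝒫_n} RSST_[m](λ') × B_n(λ)`; the first component is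
encoded by `P = P₀` (whose columns, weakly increasing with entries in
`{1, …, m}`, are the rows of `P₀ᵗ ∈ RSST_[m](λ')`). -/
def InTargetDual (m n s : ℕ) (μ : ℕ → ℕ) (P Q : ℕ → ℕ → ℤ) : Prop :=
  ShapeOK' n s μ ∧ PadZeroT s μ P ∧ PadZeroT s μ Q ∧
  (∀ t < s, ∀ x : ℕ, x + 1 < μ t → P x t ≤ P (x + 1) t) ∧
  (∀ t < s, ∀ x < μ t, 1 ≤ P x t ∧ P x t ≤ (m : ℤ)) ∧
  (∀ t < s, ∀ x : ℕ, x + 1 < μ t → Q x t < Q (x + 1) t) ∧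
  (∀ t < s, Q (μ t - 1) t - Q 0 t < (n : ℤ)) ∧
    ∀ t : ℕ, t + 1 < s → μ t = μ (t + 1) → ∀ x < μ t, Q x t ≤ Q x (t + 1)

/-- Dominance of a triple `(P, Q, ρ)`: within each rectangle block, the
sequence `ρ - ζ` (read right to left) is weakly decreasing, where
`ζ = θ - η` with `η`, `θ` the symmetrized offset vectors of `P`, `Q`. -/
def Dominant (m n s : ℕ) (μ : ℕ → ℕ) (P Q : ℕ → ℕ → ℤ) (ρ : ℕ → ℤ) : Prop :=
  ∀ t : ℕ, t + 1 < s → μ t = μ (t + 1) →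
    ρ t - ((etaCol n μ Q t : ℤ) - (etaCol m μ P t : ℤ)) ≤
      ρ (t + 1) - ((etaCol n μ Q (t + 1) : ℤ) - (etaCol m μ P (t + 1) : ℤ))

/-- `κ₀(A) = (P, Q, ρ)` with all data normalized outside the shape. -/
def Kappa0RelPad (m n : ℕ) (A : Mat) (s : ℕ) (μ : ℕ → ℕ) (P Q : ℕ → ℕ → ℤ)
    (ρ : ℕ → ℤ) : Prop :=
  ∃ P' Q' : ℕ → ℕ → ℤ,
    Kappa0Rel m n A s μ P' Q' ρ ∧
    (∀ t < s, ∀ x < μ t, P x t = P' x t ∧ Q x t = Q' x t) ∧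
    PadZeroT s μ P ∧ PadZeroT s μ Q ∧ (∀ t : ℕ, s ≤ t → μ t = 0) ∧
      ∀ t : ℕ, s ≤ t → ρ t = 0

/-- Membership in `Ω_dom`. -/
def InOmegaDom (m n s : ℕ) (μ : ℕ → ℕ) (P Q : ℕ → ℕ → ℤ) (ρ : ℕ → ℤ) : Prop :=
  ShapeOK m n s μ ∧ PadZeroT s μ P ∧ PadZeroT s μ Q ∧ (∀ t : ℕ, s ≤ t → ρ t = 0) ∧
  (∀ t < s, ∀ x : ℕ, x + 1 < μ t → P x t < P (x + 1) t) ∧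
  (∀ t < s, ∀ x < μ t, 1 ≤ P x t ∧ P x t ≤ (m : ℤ)) ∧
  (∀ t < s, ∀ x : ℕ, x + 1 < μ t → Q x t < Q (x + 1) t) ∧
  (∀ t < s, ∀ x < μ t, 1 ≤ Q x t ∧ Q x t ≤ (n : ℤ)) ∧
    Dominant m n s μ P Q ρ

/-- `A` has width `l`: some proper numbering has period `l`. -/
def HasWidth (m n : ℕ) (A : Mat) (l : ℕ) : Prop :=
  ∃ d : Cell → ℤ, IsProper A d ∧ ∀ c ∈ supp A, d (tauC m n c) = d c + (l : ℤ)

/-! ### Crystal operators on matrices -/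

/-- The first `+` of column `j` (row `i`) survives the signature reduction of
the sequence `σ` attached to rows `i, i+1`. -/
def SurvPlus (A : Mat) (i j : ℤ) : Prop :=
  0 < A i j ∧ ∀ j' : ℤ, j < j' →
    (∑ t ∈ Finset.Ioc j j', A (i + 1) t) ≤ (A i j - 1) + ∑ t ∈ Finset.Ioo j j', A i t

/-- The last `-` of column `j` (row `i+1`) survives the reduction. -/
def SurvMinus (A : Mat) (i j : ℤ) : Prop :=
  0 < A (i + 1) j ∧ ∀ j' : ℤ, j' < j →
    (∑ t ∈ Finset.Ico j' j, A i t) ≤ (A (i + 1) j - 1) + ∑ t ∈ Finset.Ioo j' j, A (i + 1) t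

/-- `A - Ê_{i₁ j} + Ê_{i₂ j}`. -/
noncomputable def subAddAt (m n : ℕ) (i₁ i₂ j : ℤ) (A : Mat) : Mat :=
  fun x y =>
    if ∃ k : ℤ, x = i₁ + k * m ∧ y = j + k * n then A x y - 1
    else if ∃ k : ℤ, x = i₂ + k * m ∧ y = j + k * n then A x y + 1
    else A x y

/-- `f̃_i` on `M̂_{m×n}`, `0`-valued results encoded by `none`. -/
noncomputable def fMat (m n : ℕ) (i : ℤ) (A : Mat) : Option Mat :=
  if h : ∃ j : ℤ, SurvPlus A i j ∧ ∀ j' : ℤ, SurvPlus A i j' → j ≤ j' then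
    some (subAddAt m n i (i + 1) h.choose A)
  else none

/-- `ẽ_i` on `M̂_{m×n}`. -/
noncomputable def eMat (m n : ℕ) (i : ℤ) (A : Mat) : Option Mat :=
  if h : ∃ j : ℤ, SurvMinus A i j ∧ ∀ j' : ℤ, SurvMinus A i j' → j' ≤ j then
    some (subAddAt m n (i + 1) i h.choose A)
  else none

def transM (A : Mat) : Mat := fun i j => A j i

/-- `f̃^t_j A = (f̃_j (Aᵗ))ᵗ`. -/
noncomputable def fMatT (m n : ℕ) (j : ℤ) (A : Mat) : Option Mat :=
  (fMat n m j (transM A)).map transM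

/-- `ẽ^t_j A = (ẽ_j (Aᵗ))ᵗ`. -/
noncomputable def eMatT (m n : ℕ) (j : ℤ) (A : Mat) : Option Mat :=
  (eMat n m j (transM A)).map transM

/-- Row operator (`f̃_i` if `x = true`, `ẽ_i` if `x = false`) on `M̂ ∪ {0}`. -/
noncomputable def rowOp (m n : ℕ) (x : Bool) (i : ℤ) (o : Option Mat) : Option Mat :=
  o.bind (if x then fMat m n i else eMat m n i)

/-- Column operator (`f̃^t_j` or `ẽ^t_j`) on `M̂ ∪ {0}`. -/
noncomputable def colOp (m n : ℕ) (y : Bool) (j : ℤ) (o : Option Mat) : Option Mat :=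
  o.bind (if y then fMatT m n j else eMatT m n j)

/-- The `+` of row `u`, column `j` survives the signature reduction of the
sequence attached to columns `j, j+1` (read along rows, top to bottom). -/
def ColSurvPlus (A : Mat) (j u : ℤ) : Prop :=
  0 < A u j ∧ ∀ u' : ℤ, u < u' →
    (∑ i ∈ Finset.Ioc u u', A i (j + 1)) ≤ (A u j - 1) + ∑ i ∈ Finset.Ioo u u', A i j

/-- `A - Ê_{u j} + Ê_{u, j+1}`, the result of `f̃^t_j` acting at row `u`. -/
noncomputable def ftApply (m n : ℕ) (u j : ℤ) (A : Mat) : Mat :=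
  fun x y =>
    if ∃ k : ℤ, x = u + k * m ∧ y = j + k * n then A x y - 1
    else if ∃ k : ℤ, x = u + k * m ∧ y = j + 1 + k * n then A x y + 1
    else A x y

/-! ### Crystal operators on tableaux -/

/-- Column `t` of `P` contributes a `+` for the letter `i`. -/
def PhasPlus (μ : ℕ → ℕ) (P : ℕ → ℕ → ℤ) (i : ℤ) (t : ℕ) : Prop :=
  (∃ x < μ t, P x t = i) ∧ ∀ x < μ t, P x t ≠ i + 1

/-- Column `t` of `P` contributes a `-` for the letter `i`. -/
def PhasMinus (μ : ℕ → ℕ) (P : ℕ → ℕ → ℤ) (i : ℤ) (t : ℕ) : Prop :=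
  (∃ x < μ t, P x t = i + 1) ∧ ∀ x < μ t, P x t ≠ i

/-- The `+` of column `t` survives the tensor-product signature reduction
(factors are the columns read from right to left). -/
def PSurvPlus (μ : ℕ → ℕ) (P : ℕ → ℕ → ℤ) (i : ℤ) (t : ℕ) : Prop :=
  PhasPlus μ P i t ∧ ∀ t' < t,
    ((Finset.Ico t' t).filter (fun u => PhasMinus μ P i u)).card ≤
      ((Finset.Ioo t' t).filter (fun u => PhasPlus μ P i u)).card

def PSurvMinus (μ : ℕ → ℕ) (P : ℕ → ℕ → ℤ) (i : ℤ) (t : ℕ) : Prop :=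
  PhasMinus μ P i t ∧ ∀ t'' : ℕ, t < t'' →
    ((Finset.Ioc t t'').filter (fun u => PhasPlus μ P i u)).card ≤
      ((Finset.Ioo t t'').filter (fun u => PhasMinus μ P i u)).card

/-- `f̃_i` on `P` acting on column `t₀` (replace the letter `i` by `i + 1`). -/
noncomputable def applyPF (μ : ℕ → ℕ) (P : ℕ → ℕ → ℤ) (i : ℤ) (t₀ : ℕ) :
    ℕ → ℕ → ℤ :=
  fun x t => if t = t₀ ∧ x < μ t ∧ P x t = i then i + 1 else P x t

/-- `ẽ_i` on `P` acting on column `t₀`. -/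
noncomputable def applyPE (μ : ℕ → ℕ) (P : ℕ → ℕ → ℤ) (i : ℤ) (t₀ : ℕ) :
    ℕ → ℕ → ℤ :=
  fun x t => if t = t₀ ∧ x < μ t ∧ P x t = i + 1 then i else P x t

/-- The entry at position `k` of a column `c` of height `b` can be increased. -/
def QmovUp (n b : ℕ) (c : ℕ → ℤ) (k : ℕ) : Prop :=
  (k + 1 < b ∧ c k + 1 < c (k + 1)) ∨ (k + 1 = b ∧ c (b - 1) < c 0 + (n : ℤ) - 1)

/-- The entry at position `k` of a column `c` of height `b` can be decreased. -/
def QmovDown (n b : ℕ) (c : ℕ → ℤ) (k : ℕ) : Prop :=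
  (0 < k ∧ c (k - 1) < c k - 1) ∨ (k = 0 ∧ c (b - 1) < c 0 + (n : ℤ) - 1)

def QhasPlus (n : ℕ) (μ : ℕ → ℕ) (Q : ℕ → ℕ → ℤ) (j : ℤ) (t : ℕ) : Prop :=
  ∃ k < μ t, Int.emod (Q k t) (n : ℤ) = j ∧ QmovUp n (μ t) (fun y => Q y t) k

def QhasMinus (n : ℕ) (μ : ℕ → ℕ) (Q : ℕ → ℕ → ℤ) (j : ℤ) (t : ℕ) : Prop :=
  ∃ k < μ t, Int.emod (Q k t) (n : ℤ) = Int.emod (j + 1) (n : ℤ) ∧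
    QmovDown n (μ t) (fun y => Q y t) k

def QSurvPlus (n : ℕ) (μ : ℕ → ℕ) (Q : ℕ → ℕ → ℤ) (j : ℤ) (t : ℕ) : Prop :=
  QhasPlus n μ Q j t ∧ ∀ t' < t,
    ((Finset.Ico t' t).filter (fun u => QhasMinus n μ Q j u)).card ≤
      ((Finset.Ioo t' t).filter (fun u => QhasPlus n μ Q j u)).card

def QSurvMinus (n : ℕ) (μ : ℕ → ℕ) (Q : ℕ → ℕ → ℤ) (j : ℤ) (t : ℕ) : Prop :=
  QhasMinus n μ Q j t ∧ ∀ t'' : ℕ, t < t'' →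
    ((Finset.Ioc t t'').filter (fun u => QhasPlus n μ Q j u)).card ≤
      ((Finset.Ioo t t'').filter (fun u => QhasMinus n μ Q j u)).card

/-- `f̃^t_j` on `Q` acting on column `t₀`. -/
noncomputable def applyQF (n : ℕ) (μ : ℕ → ℕ) (Q : ℕ → ℕ → ℤ) (j : ℤ) (t₀ : ℕ) :
    ℕ → ℕ → ℤ :=
  fun x t =>
    if t = t₀ ∧ x < μ t ∧ Int.emod (Q x t) (n : ℤ) = j ∧
        QmovUp n (μ t) (fun y => Q y t) x
    then Q x t + 1 else Q x t

/-- `ẽ^t_j` on `Q` acting on column `t₀`. -/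
noncomputable def applyQE (n : ℕ) (μ : ℕ → ℕ) (Q : ℕ → ℕ → ℤ) (j : ℤ) (t₀ : ℕ) :
    ℕ → ℕ → ℤ :=
  fun x t =>
    if t = t₀ ∧ x < μ t ∧ Int.emod (Q x t) (n : ℤ) = Int.emod (j + 1) (n : ℤ) ∧
        QmovDown n (μ t) (fun y => Q y t) x
    then Q x t - 1 else Q x t

/-! ### Standardization -/

noncomputable def rowSumA (A : Mat) (i : ℤ) : ℕ := ∑ᶠ j : ℤ, A i j

noncomputable def colSumA (A : Mat) (j : ℤ) : ℕ := ∑ᶠ i : ℤ, A i j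

/-- `A ∈ M̂_{m×n}(α, β)`. -/
def InMhatAB (m n : ℕ) (α β : ℕ → ℕ) (A : Mat) : Prop :=
  IsGAP m n A ∧ (∀ i : ℕ, 1 ≤ i → i ≤ m → rowSumA A i = α i) ∧
    ∀ j : ℕ, 1 ≤ j → j ≤ n → colSumA A j = β j

/-- Extended affine permutations `W̃_K`. -/
def IsEAP (K : ℕ) (B : Mat) : Prop :=
  IsGAP K K B ∧ (∀ i j : ℤ, B i j ≤ 1) ∧ (∀ i : ℤ, ∃! j : ℤ, B i j ≠ 0) ∧
    ∀ j : ℤ, ∃! i : ℤ, B i j ≠ 0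

/-- `i` is a descent of the matrix `B`. -/
def IsDescentM (B : Mat) (i : ℤ) : Prop :=
  ∃ j j' : ℤ, B i j ≠ 0 ∧ B (i + 1) j' ≠ 0 ∧ j' < j

/-- Partial sums `α₁ + ⋯ + α_i`. -/
def psum (α : ℕ → ℕ) (i : ℕ) : ℕ := ∑ u ∈ Finset.Icc 1 i, α u

/-- `B` is `α`-descending. -/
def AlphaDescending (m : ℕ) (α : ℕ → ℕ) (B : Mat) : Prop :=
  ∀ k : ℕ, 1 ≤ k → k ≤ m → ∀ i : ℤ,
    (psum α (k - 1) : ℤ) < i → i < (psum α k : ℤ) → IsDescentM B i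

/-- `B` is `(α, β)`-descending. -/
def IsABDescending (m n : ℕ) (α β : ℕ → ℕ) (B : Mat) : Prop :=
  AlphaDescending m α B ∧ AlphaDescending n β (transM B)

/-- `B` standardizes `A`: blockwise entry sums of `B` over `𝓘_i × 𝓙_j`
equal the entries of `A`. -/
def PermOf (m n K : ℕ) (α β : ℕ → ℕ) (A B : Mat) : Prop :=
  ∀ (i₀ j₀ : ℕ) (q r : ℤ), 1 ≤ i₀ → i₀ ≤ m → 1 ≤ j₀ → j₀ ≤ n →
    A ((i₀ : ℤ) + q * m) ((j₀ : ℤ) + r * n) =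
      ∑ k ∈ Finset.Icc ((psum α (i₀ - 1) : ℤ) + q * K + 1) ((psum α i₀ : ℤ) + q * K),
        ∑ l ∈ Finset.Icc ((psum β (j₀ - 1) : ℤ) + r * K + 1) ((psum β j₀ : ℤ) + r * K),
          B k l

/-- Standardization of a column-semistandard tableau: for each value `v`, its
occurrences, from left to right, are replaced by consecutive integers starting
after the number of strictly smaller entries. -/
noncomputable def stdT (s : ℕ) (μ : ℕ → ℕ) (T : ℕ → ℕ → ℤ) : ℕ → ℕ → ℤ :=
  fun x t =>
    ((∑ t' ∈ Finset.range s,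
        ((Finset.range (μ t')).filter (fun x' => T x' t' < T x t)).card : ℕ) : ℤ) +
      (((Finset.range t).filter (fun t' => ∃ x' < μ t', T x' t' = T x t)).card : ℤ) + 1

/-- `i` is a (column) descent of the tableau `T`: the letter `i + 1` occurs in
a column strictly to the right of the column containing `i`. -/
def IsDescentT (s : ℕ) (μ : ℕ → ℕ) (T : ℕ → ℕ → ℤ) (i : ℤ) : Prop :=
  ∃ t < s, ∃ t' < s, ∃ x < μ t, ∃ x' < μ t', T x t = i ∧ T x' t' = i + 1 ∧ t < t'

/-! ### Rectangles, `B_n(R)` and `B_n(R)₀` (columns indexed from the right) -/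

/-- `T ∈ B_n(R)` for the rectangle `R = (a^b)`; `T j x` is the entry at row `x`
of the `(j+1)`-st column from the right, normalized to `0` outside the shape. -/
def InBnR (n a b : ℕ) (T : ℕ → ℕ → ℤ) : Prop :=
  (∀ j : ℕ, j + 1 < a → ∀ x < b, T (j + 1) x ≤ T j x) ∧
  (∀ j < a, ∀ x : ℕ, x + 1 < b → T j x < T j (x + 1)) ∧
  (∀ j < a, T j (b - 1) - T j 0 < (n : ℤ)) ∧
    ∀ j x : ℕ, a ≤ j ∨ b ≤ x → T j x = 0

/-- `T ∈ B_n(R)₀`: `(T^{j+1}, τ_n^{-1}(T^j))` is not semistandard for any `j`. -/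
def InBnR0 (n a b : ℕ) (T : ℕ → ℕ → ℤ) : Prop :=
  InBnR n a b T ∧
    ∀ j : ℕ, j + 1 < a → ¬ ∀ x < b, T (j + 1) x ≤ tauPow n b (-1) (fun y => T j y) x

/-- `ν ∈ 𝒫_{a-1}`: a partition `ν₁ ≥ ⋯ ≥ ν_{a-1} ≥ 0`, normalized. -/
def IsPartLen (a : ℕ) (ν : ℕ → ℕ) : Prop :=
  ν 0 = 0 ∧ (∀ j : ℕ, 1 ≤ j → j + 2 ≤ a → ν (j + 1) ≤ ν j) ∧ ∀ j : ℕ, a ≤ j → ν j = 0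

/-- `(T, ν) ↦ τ_n^{ν_rev}(T)`: the column `j` (from the right, 0-based) is
shifted by `τ_n^{ν_{j+1}}`. -/
noncomputable def PhiMap (n a b : ℕ) (T : ℕ → ℕ → ℤ) (ν : ℕ → ℕ) : ℕ → ℕ → ℤ :=
  fun j x => if j < a ∧ x < b then tauPow n b ((ν (j + 1) : ℤ)) (fun y => T j y) x else 0

/-- The offset `r_j` of `T` (columns from the right, paper indexing `j ≥ 1`). -/
noncomputable def rOffR (n b : ℕ) (T : ℕ → ℕ → ℤ) (j : ℕ) : ℕ :=
  sInf {r : ℕ | ∀ x < b, T j x ≤ tauPow n b ((r : ℤ)) (fun y => T (j - 1) y) x}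

/-- The symmetrized offset `η_j = r_j + ⋯ + r_{a-1}`. -/
noncomputable def etaR (n a b : ℕ) (T : ℕ → ℕ → ℤ) (j : ℕ) : ℕ :=
  ∑ u ∈ Finset.Icc j (a - 1), rOffR n b T u

/-! ### The two-column setup -/

/-- Row coordinates of the stream with defining data `(a, ·, ρ)`:
`X(p + ρ + ql) = a(p) + qm` for `1 ≤ p ≤ l`. -/
def streamX (m l : ℕ) (a : ℕ → ℤ) (ρ : ℤ) (idx : ℤ) : ℤ := colExt m l a (idx - ρ - 1)

/-- Column coordinates: `Y(p + ql) = b(p) + qn` for `1 ≤ p ≤ l`. -/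
def streamY (n l : ℕ) (b : ℕ → ℤ) (idx : ℤ) : ℤ := colExt n l b (idx - 1)

/-- The matrix built from the interleaved streams `t` and `t'`. -/
noncomputable def twoColMat (m n l : ℕ) (a1 a2 b1 b2 : ℕ → ℤ) (ρ₁ ρ₂ k : ℤ) : Mat :=
  fun x y =>
    (if ∃ i : ℤ, streamX m l a2 ρ₂ (i + k) = x ∧ streamY n l b1 i = y then 1 else 0) +
      (if ∃ i : ℤ, streamX m l a1 ρ₁ i = x ∧ streamY n l b2 (i + k) = y then 1 else 0)


/-! ### Helper material -/

def Tk (m n : ℕ) (k : ℤ) (c : Cell) : Cell := (c.1 + k * m, c.2 + k * n)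

theorem Tk_zero (m n : ℕ) (c : Cell) : Tk m n 0 c = c := by simp [Tk]

theorem Tk_Tk (m n : ℕ) (a b : ℤ) (c : Cell) : Tk m n a (Tk m n b c) = Tk m n (a + b) c := by
  simp only [Tk, Prod.mk.injEq]; constructor <;> ring

theorem Tk_neg (m n : ℕ) (a : ℤ) (c : Cell) : Tk m n (-a) (Tk m n a c) = c := by
  rw [Tk_Tk]; simp [Tk]

theorem Tk_neg' (m n : ℕ) (a : ℤ) (c : Cell) : Tk m n a (Tk m n (-a) c) = c := by
  rw [Tk_Tk]; simp [Tk]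

theorem NW_Tk (m n : ℕ) (k : ℤ) (c p : Cell) : NW (Tk m n k c) (Tk m n k p) ↔ NW c p := by
  simp [NW, Tk]

theorem NW_trans {a b c : Cell} (h : NW a b) (h' : NW b c) : NW a c :=
  ⟨h.1.trans h'.1, h.2.trans h'.2⟩

theorem tauC_eq (m n : ℕ) (c : Cell) : tauC m n c = Tk m n 1 c := by simp [tauC, Tk]

theorem NW_Tk_lt {m n : ℕ} (hm : 0 < m) {k k' : ℤ} {c : Cell}
    (h : NW (Tk m n k c) (Tk m n k' c)) : k < k' := by
  have h1 := h.1
  simp only [Tk] at h1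
  have : k * (m:ℤ) < k' * m := by linarith
  exact lt_of_mul_lt_mul_right this (by positivity)

theorem NW_Tk_of_lt {m n : ℕ} (hm : 0 < m) (hn : 0 < n) {k k' : ℤ} {c : Cell}
    (h : k < k') : NW (Tk m n k c) (Tk m n k' c) := by
  have hm' : (0:ℤ) < m := by exact_mod_cast hm
  have hn' : (0:ℤ) < n := by exact_mod_cast hn
  constructor <;> simp only [Tk] <;> nlinarith

theorem st_Tk {m n l : ℕ} {e : ℤ → Cell} (h : IsStreamEnum m n e l) (k : ℤ) :
    ∀ i : ℤ, e (i + k * l) = Tk m n k (e i) := by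
  induction k using Int.induction_on with
  | zero => intro i; simp [Tk]
  | succ k ih =>
    intro i
    have := h.2.2 (i + k * l)
    rw [ih i, tauC_eq, Tk_Tk] at this
    rw [show i + ((k:ℤ) + 1) * l = i + k * l + l by ring, ← this, add_comm]
  | pred k ih =>
    intro i
    have := h.2.2 (i + (-(k:ℤ) - 1) * l)
    rw [show i + (-(k:ℤ) - 1) * l + l = i + (-k) * l by ring, ih i, tauC_eq] at this
    have h2 := congrArg (Tk m n (-1)) this
    rw [Tk_neg, Tk_Tk] at h2
    rw [h2]; congr 1; ring

theorem st_lt {m n l : ℕ} {e : ℤ → Cell} (h : IsStreamEnum m n e l) {i i' : ℤ} (hi : i < i') :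
    NW (e i) (e i') := by
  obtain ⟨k, rfl⟩ : ∃ k : ℕ, i' = i + 1 + k := ⟨(i' - i - 1).toNat, by omega⟩
  clear hi
  induction k with
  | zero => simpa using h.2.1 i
  | succ k ih =>
    have := h.2.1 (i + 1 + k)
    push_cast
    rw [← add_assoc]
    exact NW_trans ih this

theorem st_below {m n l : ℕ} (hm : 0 < m) (hn : 0 < n) {e : ℤ → Cell}
    (h : IsStreamEnum m n e l) (p : Cell) : ∃ i, NW (e i) p := by
  refine ⟨0 + (-(|p.1| + |p.2| + |(e 0).1| + |(e 0).2| + 1)) * l, ?_⟩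
  rw [st_Tk h]
  have hm' : (1:ℤ) ≤ m := by exact_mod_cast hm
  have hn' : (1:ℤ) ≤ n := by exact_mod_cast hn
  set K := |p.1| + |p.2| + |(e 0).1| + |(e 0).2| + 1
  have a1 := neg_abs_le p.1
  have a2 := neg_abs_le p.2
  have a3 := le_abs_self (e 0).1
  have a4 := le_abs_self (e 0).2
  have b1 := abs_nonneg p.1
  have b2 := abs_nonneg p.2
  have b3 := abs_nonneg (e 0).1
  have b4 := abs_nonneg (e 0).2
  have hK : 0 ≤ K := by positivity
  constructor <;> simp only [Tk] <;> nlinarith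

theorem st_above {m n l : ℕ} (hm : 0 < m) (hn : 0 < n) {e : ℤ → Cell}
    (h : IsStreamEnum m n e l) (p : Cell) : ∃ N, ∀ i, N ≤ i → NW p (e i) := by
  obtain ⟨N, hN⟩ : ∃ N, NW p (e N) := by
    refine ⟨0 + (|p.1| + |p.2| + |(e 0).1| + |(e 0).2| + 1) * l, ?_⟩
    rw [st_Tk h]
    have hm' : (1:ℤ) ≤ m := by exact_mod_cast hm
    have hn' : (1:ℤ) ≤ n := by exact_mod_cast hn
    set K := |p.1| + |p.2| + |(e 0).1| + |(e 0).2| + 1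
    have a1 := le_abs_self p.1
    have a2 := le_abs_self p.2
    have a3 := neg_abs_le (e 0).1
    have a4 := neg_abs_le (e 0).2
    have b1 := abs_nonneg p.1
    have b2 := abs_nonneg p.2
    have b3 := abs_nonneg (e 0).1
    have b4 := abs_nonneg (e 0).2
    have hK : 0 ≤ K := by positivity
    constructor <;> simp only [Tk] <;> nlinarith
  refine ⟨N, fun i hi => ?_⟩
  rcases hi.eq_or_lt with rfl | hi
  · exact hN
  · exact NW_trans hN (st_lt h hi)

/-- Flow bound from a periodic strict numbering. -/
theorem st_mono {m n l' : ℕ} {B : Mat} {D : Cell → ℤ}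
    (hlt : ∀ c ∈ supp B, ∀ p ∈ supp B, NW c p → D c < D p)
    {f : ℤ → Cell} (hf : IsStreamEnum m n f l') (hfB : ∀ i, f i ∈ supp B) (i : ℤ) (k : ℕ) :
    D (f i) + k ≤ D (f (i + k)) := by
  induction k with
  | zero => simp
  | succ k ih =>
    have := hlt _ (hfB (i + k)) _ (hfB (i + k + 1)) (hf.2.1 _)
    push_cast
    rw [← add_assoc i]
    omega

theorem flow_le {m n l l' : ℕ} {B : Mat} {D : Cell → ℤ}
    (hlt : ∀ c ∈ supp B, ∀ p ∈ supp B, NW c p → D c < D p)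
    (hper : ∀ c ∈ supp B, D (Tk m n 1 c) = D c + l)
    {f : ℤ → Cell} (hf : IsStreamEnum m n f l') (hfB : ∀ i, f i ∈ supp B) : l' ≤ l := by
  have := st_mono hlt hf hfB 0 l'
  rw [← hf.2.2, tauC_eq, hper _ (hfB 0)] at this
  omega

theorem st_level {m n l : ℕ} {B : Mat} {D : Cell → ℤ}
    (hlt : ∀ c ∈ supp B, ∀ p ∈ supp B, NW c p → D c < D p)
    (hper : ∀ c ∈ supp B, D (Tk m n 1 c) = D c + l)
    {f : ℤ → Cell} (hf : IsStreamEnum m n f l) (hfB : ∀ i, f i ∈ supp B) :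
    ∃ κ : ℤ, ∀ i, D (f i) = i + κ := by
  have hl := hf.1
  have step : ∀ i, D (f (i + 1)) = D (f i) + 1 := by
    intro i
    have h1 := st_mono hlt hf hfB i 1
    have h2 := st_mono hlt hf hfB (i + 1) (l - 1)
    rw [show i + 1 + ((l - 1 : ℕ) : ℤ) = i + l by omega, ← hf.2.2, tauC_eq, hper _ (hfB i)] at h2
    push_cast at h1
    omega
  refine ⟨D (f 0), fun i => ?_⟩
  induction i using Int.induction_on with
  | zero => simp
  | succ k ih => rw [step, ih]; ring
  | pred k ih =>
    have := step (-(k:ℤ) - 1)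
    rw [sub_add_cancel, ih] at this
    omega

theorem st_shift {m n l : ℕ} {f : ℤ → Cell} (hf : IsStreamEnum m n f l) (κ : ℤ) :
    IsStreamEnum m n (fun i => f (i + κ)) l := by
  refine ⟨hf.1, fun i => ?_, fun i => ?_⟩
  · have := hf.2.1 (i + κ)
    rwa [add_right_comm] at this
  · have := hf.2.2 (i + κ)
    rwa [add_right_comm] at this

theorem range_shift (f : ℤ → Cell) (κ : ℤ) : Set.range (fun i => f (i + κ)) = Set.range f := by
  ext c; constructor
  · rintro ⟨i, rfl⟩; exact ⟨_, rfl⟩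
  · rintro ⟨i, rfl⟩; exact ⟨i - κ, by simp⟩

/-- Replace the cell at index `i₀` (and its translates) by `w`. -/
noncomputable def repl (m n l : ℕ) (e : ℤ → Cell) (i₀ : ℤ) (w : Cell) (i : ℤ) : Cell :=
  if (l : ℤ) ∣ i - i₀ then Tk m n ((i - i₀) / l) w else e i

theorem repl_at {m n l : ℕ} (hl : 0 < l) (e : ℤ → Cell) (i₀ : ℤ) (w : Cell) (k : ℤ) :
    repl m n l e i₀ w (i₀ + k * l) = Tk m n k w := by
  have : (l:ℤ) ≠ 0 := by positivity
  simp only [repl, add_sub_cancel_left, dvd_mul_left, if_true]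
  rw [Int.mul_ediv_cancel _ this]

theorem repl_off {m n l : ℕ} (e : ℤ → Cell) (i₀ : ℤ) (w : Cell) {i : ℤ}
    (h : ¬ (l : ℤ) ∣ i - i₀) : repl m n l e i₀ w i = e i := by
  simp [repl, h]

theorem repl_stream {m n l : ℕ} (hm : 0 < m) (hn : 0 < n) {e : ℤ → Cell}
    (he : IsStreamEnum m n e l) {i₀ : ℤ} {w : Cell}
    (h : l = 1 ∨ (NW (e (i₀ - 1)) w ∧ NW w (e (i₀ + 1)))) :
    IsStreamEnum m n (repl m n l e i₀ w) l := by
  have hl := he.1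
  refine ⟨hl, fun i => ?_, fun i => ?_⟩
  · by_cases h1 : (l:ℤ) ∣ i - i₀
    · obtain ⟨k, hk⟩ := h1
      obtain rfl : i = i₀ + k * l := by linarith
      rw [repl_at hl]
      by_cases h2 : (l:ℤ) ∣ i₀ + k * l + 1 - i₀
      · have : l = 1 := by
          have : (l:ℤ) ∣ 1 := by
            have h3 : (l:ℤ) ∣ k * l := Dvd.intro_left k rfl
            have := dvd_sub h2 h3
            rwa [show i₀ + k * l + 1 - i₀ - k * l = 1 by ring] at this
          exact_mod_cast Int.eq_one_of_dvd_one (by positivity) this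
        subst this
        rw [show i₀ + k * ((1:ℕ):ℤ) + 1 = i₀ + (k + 1) * ((1:ℕ):ℤ) by push_cast; ring, repl_at hl]
        exact NW_Tk_of_lt hm hn (by omega)
      · rw [repl_off _ _ _ h2]
        rcases h with rfl | h
        · exact absurd (by simp) h2
        rw [show i₀ + k * l + 1 = i₀ + 1 + k * l by ring, st_Tk he, NW_Tk]
        exact h.2
    · rw [repl_off _ _ _ h1]
      by_cases h2 : (l:ℤ) ∣ i + 1 - i₀
      · obtain ⟨k, hk⟩ := h2
        obtain rfl : i = i₀ - 1 + k * l := by linarith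
        rw [show i₀ - 1 + k * l + 1 = i₀ + k * l by ring, repl_at hl, st_Tk he, NW_Tk]
        rcases h with rfl | h
        · exact absurd (by simp) h1
        exact h.1
      · rw [repl_off _ _ _ h2]; exact he.2.1 i
  · by_cases h1 : (l:ℤ) ∣ i - i₀
    · obtain ⟨k, hk⟩ := h1
      obtain rfl : i = i₀ + k * l := by linarith
      rw [repl_at hl, show i₀ + k * l + l = i₀ + (k + 1) * (l:ℤ) by ring, repl_at hl, tauC_eq, Tk_Tk,
        add_comm]
    · rw [repl_off _ _ _ h1, repl_off, he.2.2]
      intro h2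
      apply h1
      have := dvd_sub h2 (dvd_refl (l:ℤ))
      rwa [show i + l - i₀ - l = i - i₀ by ring] at this

structure Ctx (m n : ℕ) (A B : Mat) (u j : ℤ) (e : ℤ → Cell) (l : ℕ) (D : Cell → ℤ) : Prop where
  hm : 0 < m
  hn : 2 ≤ n
  se : IsStreamEnum m n e l
  eA : ∀ i, e i ∈ supp A
  eD : ∀ i, D (e i) = i
  perA : ∀ k c, Tk m n k c ∈ supp A ↔ c ∈ supp A
  perB : ∀ k c, Tk m n k c ∈ supp B ↔ c ∈ supp B
  perD : ∀ k c, D (Tk m n k c) = D c + k * l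
  lt : ∀ c ∈ supp A, ∀ p, NW c p → D c < D p
  ex : ∀ p, ∃ c ∈ supp A, NW c p ∧ D c = D p - 1
  best : ∀ f, IsStreamEnum m n f l → (∀ i, f i ∈ supp A) → (∀ i, D (f i) = i) →
    ∀ i, neLe (e i) (f i)
  reach : ∀ c ∈ supp A, D c ∈ chainSet A e c
  memB : ∀ c ∈ supp B, c ∈ supp A ∨ ∃ k, c = Tk m n k (u, j + 1)
  newB : ((u, j + 1) : Cell) ∈ supp B
  memA : ∀ c ∈ supp A, c ∉ supp B → ∃ k, c = Tk m n k (u, j)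
  uA : ((u, j) : Cell) ∈ supp A
  sig1 : ((u, j) : Cell) ∉ supp B → ∀ x, u < x → ((x, j + 1) : Cell) ∈ supp A →
    ∃ r, u < r ∧ r < x ∧ ((r, j) : Cell) ∈ supp A
  sig2 : ∀ x, x < u → ((x, j) : Cell) ∈ supp A → ∃ r, x < r ∧ r ≤ u ∧ ((r, j + 1) : Cell) ∈ supp A

namespace Ctx

variable {m n : ℕ} {A B : Mat} {u j : ℤ} {e : ℤ → Cell} {l : ℕ} {D : Cell → ℤ}

theorem lpos (X : Ctx m n A B u j e l D) : (0:ℤ) < l := by exact_mod_cast X.se.1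

theorem mono (X : Ctx m n A B u j e l D) {p q : Cell} (h1 : p.1 ≤ q.1) (h2 : p.2 ≤ q.2) :
    D p ≤ D q := by
  obtain ⟨c, hc, hp, hd⟩ := X.ex p
  have := X.lt c hc q ⟨lt_of_lt_of_le hp.1 h1, lt_of_lt_of_le hp.2 h2⟩
  omega

/-- a translate of `(u, j)` in column `< j + n`, `> j - n` is in column `j`. -/
theorem colj (X : Ctx m n A B u j e l D) {k : ℤ} (h : j + k * (n:ℤ) = j) : k = 0 := by
  have hn := X.hn
  have : k * (n:ℤ) = 0 := by linarith
  rcases mul_eq_zero.1 this with h | h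
  · exact h
  · omega

theorem kn1 (X : Ctx m n A B u j e l D) (k : ℤ) : k * (n:ℤ) ≠ 1 ∧ k * (n:ℤ) ≠ -1 := by
  have hn := X.hn
  constructor
  · intro h
    have : (n:ℤ) ∣ 1 := ⟨k, by linarith⟩
    have := Int.eq_one_of_dvd_one (by positivity) this
    omega
  · intro h
    have : (n:ℤ) ∣ 1 := ⟨-k, by linarith⟩
    have := Int.eq_one_of_dvd_one (by positivity) this
    omega

theorem jA_B (X : Ctx m n A B u j e l D) {r : ℤ} (hr : r ≠ u) (h : ((r, j) : Cell) ∈ supp A) :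
    ((r, j) : Cell) ∈ supp B := by
  by_contra hB
  obtain ⟨k, hk⟩ := X.memA _ h hB
  simp only [Tk, Prod.mk.injEq] at hk
  have := X.colj hk.2.symm
  subst this
  apply hr; simpa using hk.1

theorem jB_A (X : Ctx m n A B u j e l D) {r : ℤ} (h : ((r, j) : Cell) ∈ supp B) :
    ((r, j) : Cell) ∈ supp A := by
  rcases X.memB _ h with h | ⟨k, hk⟩
  · exact h
  · simp only [Tk, Prod.mk.injEq] at hk
    exact absurd (by linarith) (X.kn1 k).2

theorem j1B_A (X : Ctx m n A B u j e l D) {r : ℤ} (hr : r ≠ u)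
    (h : ((r, j + 1) : Cell) ∈ supp B) : ((r, j + 1) : Cell) ∈ supp A := by
  rcases X.memB _ h with h | ⟨k, hk⟩
  · exact h
  · simp only [Tk, Prod.mk.injEq] at hk
    have : k = 0 := X.colj (by linarith)
    subst this
    exact absurd (by simpa using hk.1) hr

theorem newlt (X : Ctx m n A B u j e l D) {c : Cell} (_hc : c ∈ supp A) (h : NW (u, j + 1) c) :
    D (u, j + 1) < D c := by
  obtain ⟨⟨x, y⟩, h0, hN, hd⟩ := X.ex (u, j + 1)
  have h1 : x < u := hN.1
  have h2 : y < j + 1 := hN.2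
  rcases lt_or_eq_of_le (show y ≤ j by omega) with hy | rfl
  · have := X.lt _ h0 (u, j) ⟨h1, hy⟩
    have := X.lt _ X.uA c ⟨h.1, by have := h.2; simp only at this ⊢; omega⟩
    omega
  · obtain ⟨r, hr1, hr2, hr⟩ := X.sig2 x h1 h0
    have := X.lt _ h0 (r, y + 1) ⟨hr1, by simp⟩
    have := X.lt _ hr c ⟨lt_of_le_of_lt hr2 h.1, h.2⟩
    omega

theorem ltB (X : Ctx m n A B u j e l D) : ∀ c ∈ supp B, ∀ p ∈ supp B, NW c p → D c < D p := by
  intro c hc p hp h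
  rcases X.memB c hc with hcA | ⟨k, rfl⟩
  · exact X.lt c hcA p h
  · rcases X.memB p hp with hpA | ⟨k', rfl⟩
    · rw [← Tk_neg' m n k p, NW_Tk] at h
      have := X.newlt ((X.perA _ _).2 hpA) h
      rw [X.perD] at this ⊢
      linarith
    · have := NW_Tk_lt X.hm h
      rw [X.perD, X.perD]
      have := X.lpos
      nlinarith

theorem s_le (X : Ctx m n A B u j e l D) : D (u, j) ≤ D (u, j + 1) := X.mono le_rfl (by simp)

/-- replacement of the removed cell. -/
theorem zz (X : Ctx m n A B u j e l D) (hu : ((u, j) : Cell) ∉ supp B) {y : Cell}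
    (hy : y ∈ supp B) (h : NW (u, j) y) (hD : D y = D (u, j) + 1) :
    ∃ y' ∈ supp B, NW y' y ∧ D y' = D (u, j) ∧ u ≤ y'.1 ∧ j ≤ y'.2 ∧
      (y' = (u, j + 1) ∨ (y'.2 = j ∧ u < y'.1)) := by
  have h2 := h.2
  simp only at h2
  have hs := X.s_le
  by_cases hy1 : y.2 = j + 1
  · obtain ⟨x, y2⟩ := y
    simp only at hy1
    subst hy1
    have h1 : u < x := h.1
    obtain ⟨r, h3, h4, h5⟩ := X.sig1 hu x h1 (X.j1B_A h1.ne' hy)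
    have hN : NW (r, j) (x, j + 1) := ⟨h4, by simp⟩
    have := X.lt _ h5 _ hN
    have := X.mono (p := (u, j)) (q := (r, j)) h3.le le_rfl
    exact ⟨(r, j), X.jA_B h3.ne' h5, hN, by omega, h3.le, le_rfl, Or.inr ⟨rfl, h3⟩⟩
  · have hN : NW (u, j + 1) y := ⟨h.1, by simp only; omega⟩
    have := X.ltB _ X.newB y hy hN
    exact ⟨_, X.newB, hN, by omega, le_rfl, by simp, Or.inl rfl⟩

theorem zzk (X : Ctx m n A B u j e l D) {c y : Cell} (hc : c ∈ supp A) (hcB : c ∉ supp B)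
    (hy : y ∈ supp B) (h : NW c y) (hD : D y = D c + 1) :
    ∃ k, c = Tk m n k (u, j) ∧ ((u, j) : Cell) ∉ supp B ∧
    ∃ y' ∈ supp B, NW y' y ∧ D y' = D c ∧ c.1 ≤ y'.1 ∧ c.2 ≤ y'.2 ∧
      (y' = Tk m n k (u, j + 1) ∨ (y'.2 = (Tk m n k (u, j)).2 ∧ (Tk m n k (u, j)).1 < y'.1)) := by
  obtain ⟨k, rfl⟩ := X.memA c hc hcB
  rw [X.perB] at hcB
  rw [← Tk_neg' m n k y, NW_Tk] at h
  obtain ⟨y', h1, h2, h3, h4, h5, h6⟩ := X.zz hcB ((X.perB (-k) y).2 hy) h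
    (by rw [X.perD] at hD ⊢; linarith)
  refine ⟨k, rfl, hcB, Tk m n k y', (X.perB _ _).2 h1, ?_, ?_, ?_, ?_, ?_⟩
  · rw [← Tk_neg' m n k y, NW_Tk]; exact h2
  · rw [X.perD, X.perD, h3]
  · simp only [Tk]; omega
  · simp only [Tk]; omega
  · rcases h6 with rfl | ⟨h6, h7⟩
    · exact Or.inl rfl
    · right; simp only [Tk]; omega

theorem exB (X : Ctx m n A B u j e l D) : ∀ c ∈ supp B, ∃ c' ∈ supp B, NW c' c ∧ D c' = D c - 1 := by
  intro c hc
  obtain ⟨c', h1, h2, h3⟩ := X.ex c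
  by_cases hB : c' ∈ supp B
  · exact ⟨c', hB, h2, h3⟩
  · obtain ⟨_, _, _, y', h4, h5, h6, _⟩ := X.zzk h1 hB hc h2 (by omega)
    exact ⟨y', h4, h5, by omega⟩

theorem properB (X : Ctx m n A B u j e l D) : IsProper B D :=
  ⟨fun c₁ h₁ c₂ h₂ h => X.ltB c₂ h₂ c₁ h₁ h, X.exB⟩

theorem repl_level (X : Ctx m n A B u j e l D) {f : ℤ → Cell} (hf : ∀ i, D (f i) = i)
    {i₀ : ℤ} {w : Cell} (hw : D w = i₀) (i : ℤ) : D (repl m n l f i₀ w i) = i := by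
  by_cases h : (l:ℤ) ∣ i - i₀
  · obtain ⟨k, hk⟩ := h
    obtain rfl : i = i₀ + k * l := by linarith
    rw [repl_at X.se.1, X.perD, hw]
  · rw [repl_off _ _ _ h, hf]

theorem repl_mem (X : Ctx m n A B u j e l D) {f : ℤ → Cell} {E : Mat}
    (hE : ∀ k c, Tk m n k c ∈ supp E ↔ c ∈ supp E)
    {i₀ : ℤ} {w : Cell} (hw : w ∈ supp E) (hf : ∀ i, ¬ (l:ℤ) ∣ i - i₀ → f i ∈ supp E) (i : ℤ) :
    repl m n l f i₀ w i ∈ supp E := by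
  by_cases h : (l:ℤ) ∣ i - i₀
  · obtain ⟨k, hk⟩ := h
    obtain rfl : i = i₀ + k * l := by linarith
    rw [repl_at X.se.1, hE]; exact hw
  · rw [repl_off _ _ _ h]; exact hf i h

/-- Lemma Y -/
theorem chanB (X : Ctx m n A B u j e l D) {f : ℤ → Cell} (hf : IsStreamEnum m n f l)
    (hfB : ∀ i, f i ∈ supp B) (hfD : ∀ i, D (f i) = i) :
    (∀ i, ¬ (l:ℤ) ∣ i - D (u, j + 1) → neLe (e i) (f i)) ∧
    (neLe (e (D (u, j + 1))) (f (D (u, j + 1))) ∨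
      (f (D (u, j + 1)) = (u, j + 1) ∧ (l ≠ 1 ∨ (e (D (u, j + 1))).2 ≤ j))) := by
  have hn0 : 0 < n := by have := X.hn; omega
  have hl := X.se.1
  set s' := D (u, j + 1) with hs'
  have hoff : ∀ i, ¬ (l:ℤ) ∣ i - s' → f i ∈ supp A := by
    intro i hi
    rcases X.memB _ (hfB i) with h | ⟨k, hk⟩
    · exact h
    · exfalso; apply hi
      have := hfD i
      rw [hk, X.perD] at this
      exact ⟨k, by rw [← this]; ring⟩
  have key : ∀ w ∈ supp A, D w = s' → (l = 1 ∨ (NW (f (s' - 1)) w ∧ NW w (f (s' + 1)))) →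
      (∀ i, ¬ (l:ℤ) ∣ i - s' → neLe (e i) (f i)) ∧ neLe (e s') w := by
    intro w hw hDw hstr
    have hb := X.best _ (repl_stream X.hm hn0 hf hstr) (X.repl_mem X.perA hw hoff)
      (X.repl_level hfD hDw)
    constructor
    · intro i hi
      have := hb i
      rwa [repl_off _ _ _ hi] at this
    · have := hb s'
      have h0 := repl_at (m := m) (n := n) hl f s' w 0
      rw [zero_mul, add_zero, Tk_zero] at h0
      rwa [h0] at this
  by_cases hA : f s' ∈ supp A
  · have := key _ hA (hfD _) (Or.inr ⟨by simpa using hf.2.1 (s' - 1), hf.2.1 s'⟩)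
    exact ⟨this.1, Or.inl this.2⟩
  · have hfs : f s' = (u, j + 1) := by
      rcases X.memB _ (hfB s') with h | ⟨k, hk⟩
      · exact absurd h hA
      · have := hfD s'
        rw [hk, X.perD] at this
        have : k * (l:ℤ) = 0 := by linarith
        have hl' := X.lpos
        rcases mul_eq_zero.1 this with h | h
        · rw [hk, h, Tk_zero]
        · omega
    have hpred : NW (f (s' - 1)) (f s') := by simpa using hf.2.1 (s' - 1)
    have hsucc := hf.2.1 s'
    rw [hfs] at hpred hsucc
    by_cases hcol : (f (s' - 1)).2 = j
    · -- column `j`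
      have hp : f (s' - 1) = ((f (s' - 1)).1, j) := by ext <;> simp [hcol]
      have hpB := hfB (s' - 1)
      have hl1 : l ≠ 1 := by
        rintro rfl
        have := st_Tk hf (-1) s'
        rw [hfs] at this
        rw [show s' + -1 * ((1:ℕ):ℤ) = s' - 1 by push_cast; ring] at this
        rw [this] at hcol
        simp only [Tk] at hcol
        exact (X.kn1 (-1)).2 (by linarith)
      rw [hp] at hpB
      have hpA := X.jB_A hpB
      obtain ⟨r, hr1, hr2, hr⟩ := X.sig2 _ hpred.1 hpA
      have hN : NW (f (s' - 1)) (r, j + 1) := ⟨hr1, hpred.2⟩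
      have h1 := X.lt _ (by rw [hp]; exact hpA) _ hN
      rw [hfD] at h1
      have h2 := X.mono (p := (r, j + 1)) (q := (u, j + 1)) hr2 le_rfl
      have := key _ hr (by omega) (Or.inr ⟨hN, ⟨lt_of_le_of_lt hr2 hsucc.1, hsucc.2⟩⟩)
      exact ⟨this.1, Or.inr ⟨hfs, Or.inl hl1⟩⟩
    · have hc : (f (s' - 1)).2 < j := by have := hpred.2; simp only at this; omega
      have hN : NW (f (s' - 1)) (u, j) := ⟨hpred.1, hc⟩
      have hs := X.s_le
      have hsu : NW (u, j) (f (s' + 1)) := ⟨hsucc.1, by have := hsucc.2; simp only at this ⊢; omega⟩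
      obtain ⟨c0, hc0, hN0, hd0⟩ := X.ex (u, j + 1)
      have hDs : D (u, j) = s' := by
        rcases eq_or_ne l 1 with rfl | hl1
        · -- flow one
          by_contra hne
          have h3 := X.lt _ X.uA (Tk m n 1 (u, j)) (by
            have := NW_Tk_of_lt (c := (u, j)) X.hm hn0 (show (0:ℤ) < 1 by norm_num)
            rwa [Tk_zero] at this)
          have hc0j : c0.2 = j := by
            by_contra hcc
            have := X.lt c0 hc0 (u, j) ⟨hN0.1, by have := hN0.2; simp only at this ⊢; omega⟩
            omega
          have hc0' : c0 = (c0.1, j) := by ext <;> simp [hc0j]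
          rw [hc0'] at hc0
          obtain ⟨r, hr1, hr2, hr⟩ := X.sig2 _ hN0.1 hc0
          have h4 := X.lt _ hc0 (r, j + 1) ⟨hr1, by simp⟩
          have h5 := X.lt _ hr (Tk m n 1 (u, j)) ⟨by
              have := X.hm; simp only [Tk]; omega, by have := X.hn; simp only [Tk]; omega⟩
          rw [X.perD] at h5
          rw [← hc0'] at h4
          push_cast at h5
          omega
        · have : f (s' - 1) ∈ supp A := hoff _ (by
            rw [show s' - 1 - s' = -1 by ring, dvd_neg]
            intro h
            have := Int.eq_one_of_dvd_one (by positivity) h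
            omega)
          have := X.lt _ this _ hN
          rw [hfD] at this
          omega
      have := key _ X.uA hDs (Or.inr ⟨hN, hsu⟩)
      exact ⟨this.1, Or.inr ⟨hfs, Or.inr this.2.2⟩⟩

theorem chain_base {E : Mat} {f : ℤ → Cell} {i : ℤ} (h : f i ∈ supp E) : i ∈ chainSet E f (f i) :=
  ⟨0, fun _ => f i, rfl, fun _ _ => h, fun i hi => absurd hi (by omega), i, rfl, by simp⟩

theorem chain_step {E : Mat} {f : ℤ → Cell} {c c' : Cell} {v : ℤ} (hc : c ∈ supp E)
    (h : NW c' c) (hv : v ∈ chainSet E f c') : v + 1 ∈ chainSet E f c := by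
  obtain ⟨k, ch, h0, h1, h2, idx, h3, h4⟩ := hv
  refine ⟨k + 1, fun i => Nat.casesOn i c ch, rfl, ?_, ?_, idx, h3, by push_cast; omega⟩
  · intro i hi
    cases i with
    | zero => exact hc
    | succ i => exact h1 i (by omega)
  · intro i hi
    cases i with
    | zero => simp only [h0]; exact h
    | succ i => exact h2 i (by omega)

theorem chain_le {E : Mat} {f : ℤ → Cell} {D : Cell → ℤ}
    (hlt : ∀ c ∈ supp E, ∀ p ∈ supp E, NW c p → D c < D p) (hD : ∀ i, D (f i) = i)
    {c : Cell} {v : ℤ} (hv : v ∈ chainSet E f c) : v ≤ D c := by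
  obtain ⟨k, ch, h0, h1, h2, idx, h3, h4⟩ := hv
  have : ∀ i ≤ k, D (ch i) + i ≤ D (ch 0) := by
    intro i hi
    induction i with
    | zero => simp
    | succ i ih =>
      have := ih (by omega)
      have := hlt _ (h1 (i + 1) hi) _ (h1 i (by omega)) (h2 i (by omega))
      push_cast; omega
  have := this k le_rfl
  rw [← h3, hD, h0] at this
  omega

theorem reachB (X : Ctx m n A B u j e l D) {e' : ℤ → Cell}
    (base : ∀ i, ∀ y ∈ supp B, NW (e i) y → D y = i + 1 → D y ∈ chainSet B e' y) :
    ∀ y ∈ supp B, D y ∈ chainSet B e' y := by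
  have W : ∀ (k : ℕ) (ch : ℕ → Cell) (idx : ℤ), (∀ i ≤ k, ch i ∈ supp A) →
      (∀ i < k, NW (ch (i + 1)) (ch i)) → e idx = ch k → D (ch 0) = idx + k →
      ∀ y ∈ supp B, NW (ch 0) y → D y = D (ch 0) + 1 → D y ∈ chainSet B e' y := by
    intro k
    induction k with
    | zero =>
      intro ch idx h1 h2 h3 h4 y hy hN hD
      rw [← h3] at hN
      exact base idx y hy hN (by rw [hD, h4]; simp)
    | succ k ih =>
      intro ch idx h1 h2 h3 h4 y hy hN hD
      have hA0 := h1 0 (by omega)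
      have hA1 := h1 1 (by omega)
      have hN1 := h2 0 (by omega)
      rw [zero_add] at hN1
      have hlt := X.lt _ hA1 _ hN1
      have hle : idx + k ≤ D (ch 1) :=
        chain_le (E := A) (f := e) (fun c hc p _ h => X.lt c hc p h) X.eD
          ⟨k, fun i => ch (i + 1), rfl, fun i hi => h1 _ (by omega), fun i hi => h2 _ (by omega),
            idx, h3, rfl⟩
      push_cast at h4
      have hW := ih (fun i => ch (i + 1)) idx (fun i hi => h1 _ (by omega))
        (fun i hi => h2 _ (by omega)) h3 (by simp only [zero_add]; omega)
      simp only [zero_add] at hW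
      by_cases hB : ch 0 ∈ supp B
      · have := chain_step hy hN (hW _ hB hN1 (by omega))
        rwa [← hD] at this
      · obtain ⟨q, _, _, y', hy', hN', hD', hr, hc, _⟩ := X.zzk hA0 hB hy hN hD
        have := chain_step hy hN' (hW y' hy' ⟨lt_of_lt_of_le hN1.1 hr, lt_of_lt_of_le hN1.2 hc⟩
          (by omega))
        rw [hD'] at this
        rwa [← hD] at this
  intro y hy
  obtain ⟨c, hc, hN, hD⟩ := X.ex y
  obtain ⟨k, ch, h0, h1, h2, idx, h3, h4⟩ := X.reach c hc
  subst h0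
  exact W k ch idx h1 h2 h3 h4 y hy hN (by omega)

theorem neLe_Tk (m n : ℕ) (k : ℤ) (c p : Cell) : neLe (Tk m n k c) (Tk m n k p) ↔ neLe c p := by
  simp [neLe, Tk]

theorem same_level {E : Mat} {D : Cell → ℤ}
    (hlt : ∀ c ∈ supp E, ∀ p ∈ supp E, NW c p → D c < D p) {c p : Cell} (hc : c ∈ supp E)
    (hp : p ∈ supp E) (h : D c = D p) : neLe c p ∨ neLe p c := by
  have h1 : ¬ NW c p := fun hh => by have := hlt _ hc _ hp hh; omega
  have h2 : ¬ NW p c := fun hh => by have := hlt _ hp _ hc hh; omega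
  simp only [NW, neLe] at *
  omega

theorem main_sw (X : Ctx m n A B u j e l D) : ∃ e' : ℤ → Cell, IsStreamEnum m n e' l ∧
    (∀ i, e' i ∈ supp B) ∧ (∀ i, D (e' i) = i) ∧
    (∀ f, IsStreamEnum m n f l → (∀ i, f i ∈ supp B) → (∀ i, D (f i) = i) →
      ∀ i, neLe (e' i) (f i)) ∧ ∀ y ∈ supp B, D y ∈ chainSet B e' y := by
  have hn0 : 0 < n := by have := X.hn; omega
  have hl := X.se.1
  have hlz := X.lpos
  by_cases ha : ∀ i, e i ∈ supp B
  · -- case (a)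
    by_cases hex : ∃ f, IsStreamEnum m n f l ∧ (∀ i, f i ∈ supp B) ∧ (∀ i, D (f i) = i) ∧
        ¬ neLe (e (D (u, j + 1))) (f (D (u, j + 1)))
    · obtain ⟨f, hf, hfB, hfD, hne⟩ := hex
      obtain ⟨hoff, h | ⟨hfs, hl1⟩⟩ := X.chanB hf hfB hfD
      · exact absurd h hne
      set s' := D (u, j + 1) with hs'
      have hsw : neLe (u, j + 1) (e s') := by
        rcases same_level X.ltB (ha s') (hfB s') (by rw [X.eD, hfD]) with h | h
        · exact absurd h hne
        · rwa [hfs] at h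
      have hl1 : l ≠ 1 := by
        rcases hl1 with h | h
        · exact h
        · have := hsw.2; simp only at this; omega
      have hnd : ∀ i : ℤ, (l:ℤ) ∣ i - s' → ¬ (l:ℤ) ∣ i - 1 - s' ∧ ¬ (l:ℤ) ∣ i + 1 - s' := by
        intro i hi
        constructor
        · intro h
          have := dvd_sub hi h
          rw [show i - s' - (i - 1 - s') = 1 by ring] at this
          have := Int.eq_one_of_dvd_one (by positivity) this
          omega
        · intro h
          have := dvd_sub h hi
          rw [show i + 1 - s' - (i - s') = 1 by ring] at this
          have := Int.eq_one_of_dvd_one (by positivity) this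
          omega
      have hnd0 := hnd s' (by simp)
      have hp : NW (f (s' - 1)) (f s') := by simpa using hf.2.1 (s' - 1)
      have hq := hf.2.1 s'
      rw [hfs] at hp hq
      have hpe : NW (e (s' - 1)) (e s') := by simpa using X.se.2.1 (s' - 1)
      have hqe := X.se.2.1 s'
      have hp1 := hoff _ hnd0.1
      have hq1 := hoff _ hnd0.2
      have hstr : IsStreamEnum m n (repl m n l e s' (u, j + 1)) l := by
        apply repl_stream X.hm hn0 X.se
        right
        simp only [NW, neLe] at *
        omega
      have hmem := X.repl_mem X.perB X.newB (f := e) (i₀ := s') (fun i _ => ha i)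
      have hlev := X.repl_level X.eD (i₀ := s') (w := (u, j + 1)) rfl
      refine ⟨_, hstr, hmem, hlev, ?_, ?_⟩
      · intro g hg hgB hgD i
        obtain ⟨goff, gs⟩ := X.chanB hg hgB hgD
        by_cases hi : (l:ℤ) ∣ i - s'
        · obtain ⟨k, hk⟩ := hi
          obtain rfl : i = s' + k * l := by linarith
          rw [repl_at hl, st_Tk hg, neLe_Tk]
          rcases gs with gs | ⟨gs, _⟩
          · exact ⟨gs.1.trans hsw.1, hsw.2.trans gs.2⟩
          · rw [gs]; exact ⟨le_rfl, le_rfl⟩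
        · rw [repl_off _ _ _ hi]; exact goff i hi
      · apply X.reachB
        intro i y hy hN hD
        suffices hh : i ∈ chainSet B (repl m n l e s' (u, j + 1)) (e i) by
          rw [hD]; exact chain_step hy hN hh
        by_cases hi : (l:ℤ) ∣ i - s'
        · have h1 := repl_off (m := m) (n := n) e s' (u, j + 1) (hnd i hi).1
          have h2 := chain_base (hmem (i - 1))
          rw [h1] at h2
          have h3 := chain_step (ha i) (by simpa using X.se.2.1 (i - 1)) h2
          simpa using h3
        · have h1 := repl_off (m := m) (n := n) e s' (u, j + 1) hi
          have h2 := chain_base (hmem i)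
          rwa [h1] at h2
    · push Not at hex
      refine ⟨e, X.se, ha, X.eD, ?_, ?_⟩
      · intro g hg hgB hgD i
        by_cases hi : (l:ℤ) ∣ i - D (u, j + 1)
        · obtain ⟨k, hk⟩ := hi
          obtain rfl : i = D (u, j + 1) + k * l := by linarith
          rw [st_Tk X.se, st_Tk hg, neLe_Tk]
          exact hex g hg hgB hgD
        · exact (X.chanB hg hgB hgD).1 i hi
      · apply X.reachB
        intro i y hy hN hD
        rw [hD]
        exact chain_step hy hN (chain_base (ha i))
  · -- case (b)
    push Not at ha
    obtain ⟨i, hi⟩ := ha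
    obtain ⟨k, hk⟩ := X.memA _ (X.eA i) hi
    have huB : ((u, j) : Cell) ∉ supp B := by
      rw [hk, X.perB] at hi; exact hi
    have hes : e (D (u, j)) = (u, j) := by
      have h1 := X.eD i
      rw [hk, X.perD] at h1
      have h2 := st_Tk X.se (-k) i
      rw [hk, Tk_neg, ← h1] at h2
      rw [show D (u, j) + k * (l:ℤ) + -k * l = D (u, j) by ring] at h2; exact h2
    set s := D (u, j) with hs
    have hpe : NW (e (s - 1)) (e s) := by simpa using X.se.2.1 (s - 1)
    have hqe := X.se.2.1 s
    rw [hes] at hpe hqe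
    have hcol : (e (s + 1)).2 ≠ j + 1 := by
      intro hc
      have hq : e (s + 1) = ((e (s + 1)).1, j + 1) := by ext <;> simp [hc]
      have hqA := X.eA (s + 1)
      rw [hq] at hqA
      obtain ⟨r, hr1, hr2, hr⟩ := X.sig1 huB _ hqe.1 hqA
      have hN : NW (r, j) (e (s + 1)) := ⟨hr2, hqe.2⟩
      have h1 := X.lt _ hr _ hN
      rw [X.eD] at h1
      have h2 := X.mono (p := (u, j)) (q := (r, j)) hr1.le le_rfl
      have hDr : D (r, j) = s := by omega
      have hb := X.best _ (repl_stream X.hm hn0 X.se (i₀ := s) (w := (r, j))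
        (Or.inr ⟨⟨hpe.1.trans hr1, hpe.2⟩, hN⟩))
        (X.repl_mem X.perA hr (fun i _ => X.eA i)) (X.repl_level X.eD hDr) s
      have h0 := repl_at (m := m) (n := n) hl e s (r, j) 0
      rw [zero_mul, add_zero, Tk_zero] at h0
      rw [h0, hes] at hb
      have := hb.1
      simp only at this
      omega
    have hq2 : NW (u, j + 1) (e (s + 1)) :=
      ⟨hqe.1, by have := hqe.2; simp only at this ⊢; omega⟩
    have hs' : D (u, j + 1) = s := by
      have := X.newlt (X.eA _) hq2
      rw [X.eD] at this
      have := X.s_le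
      omega
    have hp2 : NW (e (s - 1)) (u, j + 1) :=
      ⟨hpe.1, by have := hpe.2; simp only at this ⊢; omega⟩
    have hstr : IsStreamEnum m n (repl m n l e s (u, j + 1)) l :=
      repl_stream X.hm hn0 X.se (Or.inr ⟨hp2, hq2⟩)
    have hmem : ∀ i, repl m n l e s (u, j + 1) i ∈ supp B := by
      apply X.repl_mem X.perB X.newB
      intro i hi
      by_contra hB
      obtain ⟨k, hk⟩ := X.memA _ (X.eA i) hB
      have := X.eD i
      rw [hk, X.perD] at this
      exact hi ⟨k, by rw [← this]; ring⟩
    have hlev := X.repl_level X.eD hs'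
    refine ⟨_, hstr, hmem, hlev, ?_, ?_⟩
    · intro g hg hgB hgD i
      obtain ⟨goff, gs⟩ := X.chanB hg hgB hgD
      rw [hs'] at goff gs
      by_cases hi : (l:ℤ) ∣ i - s
      · obtain ⟨k, hk⟩ := hi
        obtain rfl : i = s + k * l := by linarith
        rw [repl_at hl, st_Tk hg, neLe_Tk]
        rcases gs with gs | ⟨gs, _⟩
        · rw [hes] at gs
          refine ⟨gs.1, ?_⟩
          have h2 := gs.2
          simp only at h2 ⊢
          by_contra hlt
          have hcj : (g s).2 = j := by omega
          have hgs : g s = ((g s).1, j) := by ext <;> simp [hcj]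
          have hB := hgB s
          have hne : (g s).1 ≠ u := by
            intro h
            rw [hgs, h] at hB
            exact huB hB
          have h1 := gs.1
          simp only at h1
          rw [hgs] at hB
          have hA := X.jB_A hB
          have := X.lt _ hA (u, j + 1) ⟨by simp only; omega, by simp⟩
          rw [← hgs, hgD, hs'] at this
          omega
        · rw [gs]; exact ⟨le_rfl, le_rfl⟩
      · rw [repl_off _ _ _ hi]; exact goff i hi
    · apply X.reachB
      intro i y hy hN hD
      by_cases hi : (l:ℤ) ∣ i - s
      · obtain ⟨k, hk⟩ := hi
        obtain rfl : i = s + k * l := by linarith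
        have hei : e (s + k * l) = Tk m n k (u, j) := by rw [st_Tk X.se, hes]
        have hnB : e (s + k * l) ∉ supp B := by rw [hei, X.perB]; exact huB
        obtain ⟨q, hq, _, y', hy', hN', hD', hr, hc, hor⟩ := X.zzk (X.eA _) hnB hy hN
          (by rw [X.eD]; exact hD)
        have hqk : q = k := by
          have h1 := X.eD (s + k * l)
          rw [hq, X.perD] at h1
          have : q * (l:ℤ) = k * l := by linarith
          exact mul_right_cancel₀ hlz.ne' this
        subst hqk
        rw [X.eD] at hD'
        rw [hD]
        refine chain_step hy hN' ?_
        rcases hor with hor | _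
        · have h1 := chain_base (hmem (s + q * l))
          have h2 := repl_at (m := m) (n := n) hl e s (u, j + 1) q
          rw [h2, ← hor] at h1
          exact h1
        · have h1 := chain_base (hmem (s + q * l - 1))
          have hNW : NW (repl m n l e s (u, j + 1) (s + q * l - 1)) (e (s + q * l)) := by
            by_cases hd : (l:ℤ) ∣ s + q * l - 1 - s
            · have hd' := dvd_sub (Dvd.intro_left q rfl : (l:ℤ) ∣ q * l) hd
              rw [show q * l - (s + q * l - 1 - s) = 1 by ring] at hd'
              have := Int.eq_one_of_dvd_one (by positivity) hd'
              rw [show s + q * l - 1 = s + (q - 1) * (l:ℤ) by rw [sub_mul, this]; ring, repl_at hl, hei]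
              have h3 := X.hm
              have h4 := X.hn
              constructor <;> simp only [Tk, sub_mul] <;> omega
            · rw [repl_off _ _ _ hd]
              simpa using X.se.2.1 (s + q * l - 1)
          have := chain_step hy' ⟨lt_of_lt_of_le hNW.1 hr, lt_of_lt_of_le hNW.2 hc⟩ h1
          simpa using this
      · have h1 := repl_off (m := m) (n := n) e s (u, j + 1) hi
        have h2 := chain_base (hmem i)
        rw [h1] at h2
        rw [hD]
        exact chain_step hy hN h2


theorem uniq (X : Ctx m n A B u j e l D) {d' : Cell → ℤ} (hp : IsProper B d')
    (hold : ∀ c ∈ supp A, c ∈ supp B → d' c = D c) (h0 : d' (u, j + 1) = D (u, j + 1)) :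
    ∀ c ∈ supp B, d' c = D c := by
  have hn0 : 0 < n := by have := X.hn; omega
  have hl := X.lpos
  by_cases hA : ((u, j + 1) : Cell) ∈ supp A
  · intro c hc
    refine hold c ?_ hc
    rcases X.memB c hc with h | ⟨k, rfl⟩
    · exact h
    · exact (X.perA _ _).2 hA
  obtain ⟨E, hE⟩ : ∃ E : ℤ → ℤ, ∀ k, d' (Tk m n k (u, j + 1)) = E k + (D (u, j + 1) + k * l) :=
    ⟨fun k => d' (Tk m n k (u, j + 1)) - (D (u, j + 1) + k * l), fun k => by ring⟩
  have hD : ∀ k, D (Tk m n k (u, j + 1)) = D (u, j + 1) + k * l := fun k => X.perD k _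
  have hB : ∀ k, Tk m n k (u, j + 1) ∈ supp B := fun k => (X.perB _ _).2 X.newB
  have hE0 : E 0 = 0 := by
    have := hE 0
    rw [Tk_zero, h0] at this
    linarith
  have hmono : l = 1 → ∀ i, E i ≤ E (i + 1) := by
    intro h1 i
    have := hp.1 _ (hB (i + 1)) _ (hB i) (NW_Tk_of_lt X.hm hn0 (by omega))
    rw [hE, hE, h1] at this
    push_cast at this
    linarith
  have hmono' : l = 1 → ∀ (i : ℤ) (k : ℕ), E i ≤ E (i + k) := by
    intro h1 i k
    induction k with
    | zero => simp
    | succ k ih =>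
      have := hmono h1 (i + k)
      push_cast
      rw [← add_assoc]
      linarith
  have hA1 : ∀ i, E i ≤ 0 := by
    by_contra hcon
    push Not at hcon
    obtain ⟨i0, hi0⟩ := hcon
    have step : ∀ i, 0 < E i → ∃ i', i' < i ∧ E i' = E i - 1 + (i - i') * l := by
      intro i hi
      obtain ⟨q, hq, hN, hd⟩ := hp.2 _ (hB i)
      by_cases hqA : q ∈ supp A
      · have h1 := X.lt q hqA _ hN
        rw [hold q hqA hq, hE] at hd
        rw [hD] at h1
        omega
      · rcases X.memB q hq with h | ⟨i', rfl⟩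
        · exact absurd h hqA
        · refine ⟨i', NW_Tk_lt X.hm hN, ?_⟩
          rw [hE, hE] at hd
          linarith
    have iter : ∀ N : ℕ, ∃ i, i ≤ i0 - N ∧ 1 + N * ((l:ℤ) - 1) ≤ E i := by
      intro N
      induction N with
      | zero => exact ⟨i0, by simp, by simp; omega⟩
      | succ N ih =>
        obtain ⟨i, h1, h2⟩ := ih
        have h3 : 0 ≤ (N:ℤ) * ((l:ℤ) - 1) := mul_nonneg (by positivity) (by omega)
        obtain ⟨i', h4, h5⟩ := step i (by omega)
        refine ⟨i', by push_cast; omega, ?_⟩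
        push_cast
        nlinarith
    by_cases h1 : l = 1
    · obtain ⟨i, hi, hi2⟩ := iter i0.natAbs
      have := hmono' h1 i (-i).toNat
      rw [show i + ((-i).toNat : ℤ) = 0 by omega, hE0] at this
      subst h1
      simp at hi2
      omega
    · obtain ⟨N, hN⟩ := st_above X.hm hn0 X.se (u, j + 1)
      have hl2 : (2:ℤ) ≤ l := by omega
      obtain ⟨i, hi, hdv⟩ : ∃ i, N ≤ i ∧ ¬ (l:ℤ) ∣ i - D (u, j) := by
        by_cases h : (l:ℤ) ∣ N - D (u, j)
        · refine ⟨N + 1, by omega, fun h' => ?_⟩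
          have := dvd_sub h' h
          rw [show N + 1 - D (u, j) - (N - D (u, j)) = 1 by ring] at this
          have := Int.le_of_dvd (by norm_num) this
          omega
        · exact ⟨N, le_rfl, h⟩
      have hq : e i ∈ supp B := by
        by_contra hq
        obtain ⟨k, hk⟩ := X.memA _ (X.eA i) hq
        have := X.eD i
        rw [hk, X.perD] at this
        exact hdv ⟨k, by linarith⟩
      have bound : ∀ k, E k < D (e i) - D (u, j + 1) := by
        intro k
        have := hp.1 _ ((X.perB k _).2 hq) _ (hB k) ((NW_Tk m n k _ _).2 (hN i hi))
        rw [hold _ ((X.perA k _).2 (X.eA i)) ((X.perB k _).2 hq), hE, X.perD] at this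
        linarith
      obtain ⟨k, _, hk⟩ := iter (D (e i) - D (u, j + 1)).toNat
      have := bound k
      have h5 := Int.self_le_toNat (D (e i) - D (u, j + 1))
      nlinarith
  have hB1 : ∀ i, 0 ≤ E i := by
    by_contra hcon
    push Not at hcon
    obtain ⟨i, hi⟩ := hcon
    have noold : ∀ q ∈ supp A, q ∈ supp B → NW q (Tk m n i (u, j + 1)) →
        D q ≠ D (Tk m n i (u, j + 1)) - 1 := by
      intro q h1 h2 h3 h4
      have := hp.1 _ (hB i) q h2 h3
      rw [hold q h1 h2, h4, hE, hD] at this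
      omega
    have h1 : l = 1 := by
      obtain ⟨q, hq, hN, hd⟩ := X.exB _ (hB i)
      rcases X.memB q hq with h | ⟨i', rfl⟩
      · exact absurd hd (noold q h hq hN)
      · rw [hD, hD] at hd
        have : (l:ℤ) ∣ 1 := ⟨i - i', by linarith⟩
        exact_mod_cast Int.eq_one_of_dvd_one (by positivity) this
    have step : ∀ k, E k = 0 → E (k - 1) = 0 := by
      intro k hk
      obtain ⟨q, hq, hN, hd⟩ := hp.2 _ (hB k)
      by_cases hqA : q ∈ supp A
      · exfalso
        refine noold (Tk m n (i - k) q) ((X.perA _ _).2 hqA) ((X.perB _ _).2 hq) ?_ ?_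
        · rw [show Tk m n i (u, j + 1) = Tk m n (i - k) (Tk m n k (u, j + 1)) by
            rw [Tk_Tk, sub_add_cancel], NW_Tk]
          exact hN
        · rw [hold q hqA hq, hE, hk] at hd
          rw [X.perD, hD, hd]
          ring
      · rcases X.memB q hq with h | ⟨k', rfl⟩
        · exact absurd h hqA
        · have hlt := NW_Tk_lt X.hm hN
          rw [hE, hE, hk, h1] at hd
          have := hmono' h1 k' (k - 1 - k').toNat
          rw [show k' + ((k - 1 - k').toNat : ℤ) = k - 1 by omega] at this
          have h2 := hA1 (k - 1)
          push_cast at hd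
          omega
    have hneg : ∀ N : ℕ, E (-N) = 0 := by
      intro N
      induction N with
      | zero => simpa using hE0
      | succ N ih =>
        have := step _ ih
        push_cast
        rw [neg_add]
        exact this
    rcases le_or_gt i 0 with h | h
    · have := hneg (-i).toNat
      rw [show -(((-i).toNat : ℕ) : ℤ) = i by omega] at this
      omega
    · have := hmono' h1 0 i.toNat
      rw [show (0:ℤ) + ((i.toNat : ℕ) : ℤ) = i by omega, hE0] at this
      omega
  intro c hc
  rcases X.memB c hc with h | ⟨k, rfl⟩
  · exact hold c h hc
  · rw [hE, hD]
    have := hA1 k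
    have := hB1 k
    omega

end Ctx

theorem zz_path {z : ℤ → Cell} (hz : IsZigZag z) (i : ℤ) (k : ℕ) :
    (z (i + k)).1 ≤ (z i).1 ∧ (z i).2 ≤ (z (i + k)).2 := by
  induction k with
  | zero => simp
  | succ k ih =>
    push_cast
    rw [← add_assoc]
    rcases hz.1 (i + k) with h | h <;> rw [h] <;> simp only <;> omega

theorem zz_path' {z : ℤ → Cell} (hz : IsZigZag z) {i i' : ℤ} (h : i ≤ i') :
    (z i').1 ≤ (z i).1 ∧ (z i).2 ≤ (z i').2 := by
  have := zz_path hz i (i' - i).toNat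
  rwa [show i + ((i' - i).toNat : ℤ) = i' by omega] at this

theorem exists_nwMax {S : Set Cell} (hS : S.Finite) {c : Cell} (hc : c ∈ S) :
    ∃ c' ∈ nwMaximal S, nwGe c' c := by
  have hfin : {c' ∈ S | nwGe c' c}.Finite := hS.subset (fun x hx => hx.1)
  obtain ⟨a, ha, hmin⟩ := Set.exists_min_image {c' ∈ S | nwGe c' c} (fun c' => c'.1 + c'.2) hfin
    ⟨c, hc, le_rfl, le_rfl⟩
  refine ⟨a, ⟨ha.1, fun b hb hba => ?_⟩, ha.2⟩
  have := hmin b ⟨hb, hba.1.trans ha.2.1, hba.2.trans ha.2.2⟩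
  have h1 := hba.1
  have h2 := hba.2
  exact Prod.ext (by omega) (by omega)

theorem zz_exists {S : Set Cell} (hS : S.Finite) (hne : S.Nonempty) :
    ∃ (f : ℤ → ℤ), (∀ t x, f t ≤ x ↔ ∃ c ∈ S, c.1 ≤ x ∧ c.2 ≤ x + t) ∧
      IsZigZag (fun t => (f t, f t + t)) ∧
      innerCorners (fun t => (f t, f t + t)) = nwMaximal S := by
  obtain ⟨f, hf⟩ : ∃ f : ℤ → ℤ, ∀ t x, f t ≤ x ↔ ∃ c ∈ S, c.1 ≤ x ∧ c.2 ≤ x + t := by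
    have hne' : hS.toFinset.Nonempty := by simpa using hne
    refine ⟨fun t => hS.toFinset.inf' hne' (fun c => max c.1 (c.2 - t)), fun t x => ?_⟩
    rw [Finset.inf'_le_iff]
    simp only [Set.Finite.mem_toFinset, max_le_iff, sub_le_iff_le_add]
  have step1 : ∀ t, f (t + 1) ≤ f t := by
    intro t
    obtain ⟨c, hc, h1, h2⟩ := (hf t _).1 le_rfl
    exact (hf _ _).2 ⟨c, hc, h1, by omega⟩
  have step2 : ∀ t, f t ≤ f (t + 1) + 1 := by
    intro t
    obtain ⟨c, hc, h1, h2⟩ := (hf (t + 1) _).1 le_rfl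
    exact (hf _ _).2 ⟨c, hc, by omega, by omega⟩
  refine ⟨f, hf, ⟨?_, ?_, ?_⟩, ?_⟩
  · intro i
    have h1 := step1 i
    have h2 := step2 i
    simp only [Prod.mk.injEq]
    omega
  · obtain ⟨a, ha, hmin⟩ := Set.exists_min_image S (fun c => c.1) hS hne
    have key : ∀ t, a.2 - a.1 ≤ t → f t = a.1 := by
      intro t ht
      apply le_antisymm
      · exact (hf _ _).2 ⟨a, ha, le_rfl, by omega⟩
      · obtain ⟨c, hc, h1, h2⟩ := (hf t _).1 le_rfl
        exact (hmin c hc).trans h1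
    refine ⟨a.2 - a.1, fun i hi => ?_⟩
    have h1 := key i hi
    have h2 := key (i + 1) (by omega)
    simp only [Prod.mk.injEq]
    omega
  · obtain ⟨a, ha, hmin⟩ := Set.exists_min_image S (fun c => c.2) hS hne
    have key : ∀ t, t ≤ a.2 - a.1 → f t = a.2 - t := by
      intro t ht
      apply le_antisymm
      · exact (hf _ _).2 ⟨a, ha, by omega, by omega⟩
      · obtain ⟨c, hc, h1, h2⟩ := (hf t _).1 le_rfl
        have := hmin c hc
        omega
    refine ⟨a.2 - a.1 - 1, fun i hi => ?_⟩
    have h1 := key i (by omega)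
    have h2 := key (i + 1) (by omega)
    simp only [Prod.mk.injEq]
    omega
  · ext c
    constructor
    · rintro ⟨t, rfl, h1, h2⟩
      simp only [Prod.mk.injEq] at h1 h2
      have key : ∀ c' ∈ S, nwGe c' (f t, f t + t) → c' = (f t, f t + t) := by
        intro c' hc' hnw
        have g1 := hnw.1
        have g2 := hnw.2
        simp only at g1 g2
        have g3 : f t ≤ c'.1 := by
          by_contra hcon
          have := (hf (t + 1) (f t - 1)).2 ⟨c', hc', by omega, by omega⟩
          omega
        have g4 : f t + t ≤ c'.2 := by
          by_contra hcon
          have := (hf (t - 1) (f t)).2 ⟨c', hc', by omega, by omega⟩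
          omega
        exact Prod.ext (by simp only; omega) (by simp only; omega)
      obtain ⟨c, hc, g1, g2⟩ := (hf t _).1 le_rfl
      refine ⟨?_, key⟩
      have := key c hc ⟨g1, g2⟩
      change ((f t, f t + t) : Cell) ∈ S
      rw [← this]; exact hc
    · rintro ⟨hc, hmax⟩
      obtain ⟨x, y⟩ := c
      have no : ∀ c' ∈ S, c'.1 ≤ x → c'.2 ≤ y → c'.1 = x ∧ c'.2 = y := by
        intro c' hc' g1 g2
        have := hmax c' hc' ⟨g1, g2⟩
        rw [this]; simp
      have e1 : f (y - x) = x := by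
        apply le_antisymm
        · exact (hf _ _).2 ⟨_, hc, le_rfl, by simp only; omega⟩
        · by_contra hcon
          obtain ⟨c', hc', g1, g2⟩ := (hf (y - x) (x - 1)).1 (by omega)
          have := no c' hc' (by omega) (by omega)
          omega
      have e2 : f (y - x - 1) = x + 1 := by
        have := step2 (y - x - 1)
        rw [sub_add_cancel] at this
        by_contra hcon
        obtain ⟨c', hc', g1, g2⟩ := (hf (y - x - 1) x).1 (by omega)
        have := no c' hc' (by omega) (by omega)
        omega
      have e3 : f (y - x + 1) = x := by
        have := step1 (y - x)
        by_contra hcon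
        obtain ⟨c', hc', g1, g2⟩ := (hf (y - x + 1) (x - 1)).1 (by omega)
        have := no c' hc' (by omega) (by omega)
        omega
      refine ⟨y - x, ?_, ?_, ?_⟩
      · simp only [e1, Prod.mk.injEq]; exact ⟨trivial, by ring⟩
      · simp only [e1, e2, Prod.mk.injEq]; omega
      · simp only [e1, e3, Prod.mk.injEq]; exact ⟨trivial, by ring⟩

theorem zz_iff {S : Set Cell} (hS : S.Finite) {u j : ℤ} (hu : ((u, j) : Cell) ∈ S) :
    (∃ z : ℤ → Cell, (IsZigZag z ∧ innerCorners z = nwMaximal S) ∧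
      ((u, j) : Cell) ∈ Set.range z ∧ ∀ i : ℤ, ((i, j) : Cell) ∈ Set.range z → u ≤ i) ↔
    ∀ c ∈ S, c.2 ≤ j → u ≤ c.1 := by
  constructor
  · rintro ⟨z, ⟨hz, hin⟩, ⟨t0, ht0⟩, hmin⟩ c hc hcj
    obtain ⟨c', hc', h1, h2⟩ := exists_nwMax hS hc
    refine le_trans ?_ h1
    rw [← hin] at hc'
    obtain ⟨t1, ht1, -, -⟩ := hc'
    rcases lt_or_eq_of_le (h2.trans hcj) with h | h
    · have : t1 ≤ t0 := by
        by_contra hcon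
        have := (zz_path' hz (le_of_lt (not_le.1 hcon))).2
        rw [ht0, ht1] at this
        simp only at this
        omega
      have := (zz_path' hz this).1
      rw [ht0, ht1] at this
      exact this
    · exact hmin _ ⟨t1, by rw [ht1, ← h]⟩
  · intro hT
    obtain ⟨f, hf, hz, hin⟩ := zz_exists hS ⟨_, hu⟩
    refine ⟨_, ⟨hz, hin⟩, ⟨j - u, ?_⟩, ?_⟩
    · have : f (j - u) = u := by
        apply le_antisymm
        · exact (hf _ _).2 ⟨_, hu, le_rfl, by simp only; omega⟩
        · obtain ⟨c, hc, g1, g2⟩ := (hf (j - u) _).1 le_rfl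
          by_contra hcon
          have := hT c hc (by omega)
          omega
      simp only [this, Prod.mk.injEq]; exact ⟨trivial, by ring⟩
    · rintro i ⟨t, ht⟩
      simp only [Prod.mk.injEq] at ht
      obtain ⟨c, hc, g1, g2⟩ := (hf t _).1 le_rfl
      have := hT c hc (by omega)
      omega

theorem level_finite {m n l : ℕ} {A : Mat} {d : Cell → ℤ} (hn : 0 < n) (hl : 0 < l)
    (hA : ∀ y : ℤ, {i : ℤ | A i y ≠ 0}.Finite)
    (perA : ∀ k c, Tk m n k c ∈ supp A ↔ c ∈ supp A)
    (per : ∀ k, ∀ c ∈ supp A, d (Tk m n k c) = d c + k * l) (s : ℤ) : (levelSet A d s).Finite := by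
  have hF : (⋃ y ∈ Set.Ico (0:ℤ) n, (fun i : ℤ => ((i, y) : Cell)) '' {i : ℤ | A i y ≠ 0}).Finite :=
    Set.Finite.biUnion (Set.finite_Ico _ _) (fun y _ => (hA y).image _)
  refine (hF.image (fun c => Tk m n ((s - d c) / l) c)).subset ?_
  rintro c ⟨hc, hd⟩
  have hn' : (0:ℤ) < n := by exact_mod_cast hn
  have hl' : (l:ℤ) ≠ 0 := by positivity
  have h0 : Tk m n (-(c.2 / n)) c ∈ supp A := (perA _ _).2 hc
  refine ⟨Tk m n (-(c.2 / n)) c, ?_, ?_⟩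
  · simp only [Set.mem_iUnion]
    refine ⟨(Tk m n (-(c.2 / n)) c).2, ?_, (Tk m n (-(c.2 / n)) c).1, h0, rfl⟩
    have h1 := Int.emod_nonneg c.2 hn'.ne'
    have h2 := Int.emod_lt_of_pos c.2 hn'
    have h3 := Int.emod_add_mul_ediv c.2 n
    simp only [Tk, Set.mem_Ico]
    constructor <;> nlinarith
  · simp only
    rw [per _ _ hc, hd, show s - (s + -(c.2 / n) * l) = (c.2 / n) * l by ring,
      Int.mul_ediv_cancel _ hl', Tk_neg']

namespace Ctx

variable {m n : ℕ} {A B : Mat} {u j : ℤ} {e : ℤ → Cell} {l : ℕ} {D : Cell → ℤ}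

theorem new_val (X : Ctx m n A B u j e l D) :
    ((∀ c ∈ supp A, D c = D (u, j) → c.2 ≤ j → u ≤ c.1) → D (u, j + 1) = D (u, j)) ∧
    ((¬ ∀ c ∈ supp A, D c = D (u, j) → c.2 ≤ j → u ≤ c.1) → D (u, j + 1) = D (u, j) + 1) := by
  have hs := X.s_le
  obtain ⟨p, hp, hN, hd⟩ := X.ex (u, j + 1)
  have h1 := hN.1
  have h2 := hN.2
  simp only at h1 h2
  have h3 : D p ≤ D (u, j) := X.mono (by simp only; omega) (by simp only; omega)
  constructor
  · intro hT
    by_contra hcon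
    have := hT p hp (by omega) (by omega)
    omega
  · intro hT
    push Not at hT
    obtain ⟨c, hc, h4, h5, h6⟩ := hT
    have := X.lt c hc (u, j + 1) ⟨h6, by simp only; omega⟩
    omega

end Ctx

theorem gap_Tk {m n : ℕ} {A : Mat} (hA : IsGAP m n A) (k : ℤ) : ∀ x y : ℤ,
    A (x + k * m) (y + k * n) = A x y := by
  induction k using Int.induction_on with
  | zero => intro x y; simp
  | succ k ih =>
    intro x y
    rw [← ih x y, ← hA.1 (x + k * m) (y + k * n)]
    congr 1 <;> ring
  | pred k ih =>
    intro x y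
    rw [← ih x y, ← hA.1 (x + (-(k:ℤ) - 1) * m) (y + (-(k:ℤ) - 1) * n)]
    congr 1 <;> ring

theorem supp_Tk {m n : ℕ} {A : Mat} (hA : ∀ k x y : ℤ, A (x + k * m) (y + k * n) = A x y) (k : ℤ)
    (c : Cell) : Tk m n k c ∈ supp A ↔ c ∈ supp A := by
  simp only [supp, Set.mem_ofPred_eq, Tk, hA]

theorem chain_shift {m n l : ℕ} {A : Mat} {e : ℤ → Cell} (se : IsStreamEnum m n e l)
    (perA : ∀ k c, Tk m n k c ∈ supp A ↔ c ∈ supp A) (q : ℤ) {c : Cell} {v : ℤ}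
    (hv : v ∈ chainSet A e c) : v + q * l ∈ chainSet A e (Tk m n q c) := by
  obtain ⟨k, ch, h0, h1, h2, idx, h3, h4⟩ := hv
  refine ⟨k, fun i => Tk m n q (ch i), by simp only [h0], fun i hi => (perA _ _).2 (h1 i hi),
    fun i hi => (NW_Tk _ _ _ _ _).2 (h2 i hi), idx + q * l, ?_, by rw [h4]; ring⟩
  rw [st_Tk se, h3]

theorem numbering_data {m n l : ℕ} {A : Mat} {e : ℤ → Cell} {d : Cell → ℤ}
    (se : IsStreamEnum m n e l)
    (perA : ∀ k c, Tk m n k c ∈ supp A ↔ c ∈ supp A) (eA : ∀ i, e i ∈ supp A)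
    (hnum : IsChannelNumbering A e d) :
    (∀ k, ∀ c ∈ supp A, d (Tk m n k c) = d c + k * l) ∧
    (∀ c ∈ supp A, ∀ p ∈ supp A, NW c p → d c < d p) ∧
    (∀ p ∈ supp A, ∃ c ∈ supp A, NW c p ∧ d c = d p - 1) ∧ ∀ i, d (e i) = i := by
  have per : ∀ k, ∀ c ∈ supp A, d (Tk m n k c) = d c + k * l := by
    have ge : ∀ k, ∀ c ∈ supp A, d c + k * l ≤ d (Tk m n k c) := fun k c hc =>
      (hnum _ ((perA k c).2 hc)).2 (chain_shift se perA k (hnum c hc).1)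
    intro k c hc
    have h1 := ge k c hc
    have h2 := ge (-k) _ ((perA k c).2 hc)
    rw [Tk_neg] at h2
    linarith
  have lt : ∀ c ∈ supp A, ∀ p ∈ supp A, NW c p → d c < d p := by
    intro c hc p hp h
    have := (hnum p hp).2 (Ctx.chain_step hp h (hnum c hc).1)
    omega
  have ge : ∀ i, i ≤ d (e i) := fun i => (hnum _ (eA i)).2 (Ctx.chain_base (eA i))
  refine ⟨per, lt, ?_, ?_⟩
  · intro p hp
    obtain ⟨k, ch, h0, h1, h2, idx, h3, h4⟩ := (hnum p hp).1
    cases k with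
    | zero =>
      rw [h0] at h3
      have hN : NW (e (idx - 1)) p := by
        have := se.2.1 (idx - 1)
        rwa [sub_add_cancel, h3] at this
      have g1 := ge (idx - 1)
      have g2 := lt _ (eA (idx - 1)) p hp hN
      refine ⟨_, eA (idx - 1), hN, ?_⟩
      push_cast at h4
      omega
    | succ k =>
      have hN : NW (ch 1) p := by rw [← h0]; exact h2 0 (by omega)
      have m1 : ch 1 ∈ supp A := h1 1 (by omega)
      have g1 : idx + (k:ℤ) ≤ d (ch 1) := (hnum _ m1).2
        ⟨k, fun i => ch (i + 1), rfl, fun i hi => h1 _ (by omega), fun i hi => h2 _ (by omega),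
          idx, h3, rfl⟩
      have g2 := lt _ m1 p hp hN
      refine ⟨_, m1, hN, ?_⟩
      push_cast at h4
      omega
  · obtain ⟨κ, hκ⟩ := st_level lt (fun c hc => by rw [per 1 c hc]; ring) se eA
    have := ge 0
    have h2 := Ctx.chain_le (D := fun c => d c - κ)
      (fun c hc p hp h => by have := lt c hc p hp h; omega)
      (fun i => by simp only [hκ]; ring) (hnum _ (eA 0)).1
    have h3 := hκ 0
    intro i
    have := hκ i
    omega

theorem extend_data {m n l : ℕ} (hm : 0 < m) (hn : 0 < n) {A : Mat} {e : ℤ → Cell} {d : Cell → ℤ}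
    (se : IsStreamEnum m n e l)
    (perA : ∀ k c, Tk m n k c ∈ supp A ↔ c ∈ supp A) (eA : ∀ i, e i ∈ supp A)
    (per : ∀ k, ∀ c ∈ supp A, d (Tk m n k c) = d c + k * l)
    (lt : ∀ c ∈ supp A, ∀ p ∈ supp A, NW c p → d c < d p)
    (ex : ∀ p ∈ supp A, ∃ c ∈ supp A, NW c p ∧ d c = d p - 1) :
    ∃ D : Cell → ℤ, (∀ c ∈ supp A, D c = d c) ∧ (∀ k c, D (Tk m n k c) = D c + k * l) ∧
      (∀ c ∈ supp A, ∀ p, NW c p → D c < D p) ∧ ∀ p, ∃ c ∈ supp A, NW c p ∧ D c = D p - 1 := by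
  have key : ∀ p : Cell, ∃ g : ℤ, (∃ c ∈ supp A, NW c p ∧ d c = g) ∧
      ∀ z, (∃ c ∈ supp A, NW c p ∧ d c = z) → z ≤ g := by
    intro p
    apply Int.exists_greatest_of_bdd
    · obtain ⟨N, hN⟩ := st_above hm hn se p
      refine ⟨d (e N), ?_⟩
      rintro z ⟨c, hc, h, rfl⟩
      exact (lt c hc _ (eA N) (NW_trans h (hN N le_rfl))).le
    · obtain ⟨i, hi⟩ := st_below hm hn se p
      exact ⟨_, _, eA i, hi, rfl⟩
  choose g hg1 hg2 using key
  have hD : ∀ c ∈ supp A, g c + 1 = d c := by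
    intro c hc
    obtain ⟨c', h1, h2, h3⟩ := ex c hc
    have h4 := hg2 c _ ⟨c', h1, h2, h3⟩
    obtain ⟨c'', h5, h6, h7⟩ := hg1 c
    have := lt _ h5 c hc h6
    omega
  refine ⟨fun p => g p + 1, hD, ?_, ?_, ?_⟩
  · have ge : ∀ k p, g p + k * l ≤ g (Tk m n k p) := by
      intro k p
      obtain ⟨c, h1, h2, h3⟩ := hg1 p
      exact hg2 _ _ ⟨Tk m n k c, (perA _ _).2 h1, (NW_Tk _ _ _ _ _).2 h2, by rw [per k c h1, h3]⟩
    intro k p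
    have h1 := ge k p
    have h2 := ge (-k) (Tk m n k p)
    rw [Tk_neg] at h2
    simp only
    linarith
  · intro c hc p h
    have := hg2 p _ ⟨c, hc, h, rfl⟩
    have := hD c hc
    simp only
    omega
  · intro p
    obtain ⟨c, h1, h2, h3⟩ := hg1 p
    refine ⟨c, h1, h2, ?_⟩
    have := hD c h1
    simp only
    omega

theorem orbit_iff (m n : ℕ) (u j x y q : ℤ) :
    (∃ k : ℤ, x + q * m = u + k * m ∧ y + q * n = j + k * n) ↔
      ∃ k : ℤ, x = u + k * m ∧ y = j + k * n := by
  constructor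
  · rintro ⟨k, h1, h2⟩
    exact ⟨k - q, by linarith, by linarith⟩
  · rintro ⟨k, h1, h2⟩
    exact ⟨k + q, by rw [h1]; ring, by rw [h2]; ring⟩

theorem ft_per {m n : ℕ} {A : Mat} (hA : ∀ k x y : ℤ, A (x + k * m) (y + k * n) = A x y) (u j : ℤ)
    (k x y : ℤ) : ftApply m n u j A (x + k * m) (y + k * n) = ftApply m n u j A x y := by
  simp only [ftApply, orbit_iff, hA]

theorem sig1_aux {A : Mat} {j u : ℤ} (hu : ColSurvPlus A j u) (h1 : A u j ≤ 1) {x : ℤ}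
    (hx : u < x) (hxA : A x (j + 1) ≠ 0) : ∃ r, u < r ∧ r < x ∧ A r j ≠ 0 := by
  by_contra hcon
  push Not at hcon
  have h2 := hu.2 x hx
  have h3 : ∑ i ∈ Finset.Ioo u x, A i j = 0 := Finset.sum_eq_zero (fun i hi => by
    rw [Finset.mem_Ioo] at hi; exact hcon i hi.1 hi.2)
  have h4 : A x (j + 1) ≤ ∑ i ∈ Finset.Ioc u x, A i (j + 1) :=
    Finset.single_le_sum (f := fun i => A i (j + 1)) (fun i _ => Nat.zero_le _)
      (Finset.mem_Ioc.2 ⟨hx, le_rfl⟩)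
  omega

theorem sig2_aux {A : Mat} {j u : ℤ} (hu : ColSurvPlus A j u)
    (humin : ∀ u' : ℤ, ColSurvPlus A j u' → u ≤ u') {x : ℤ}
    (hx : x < u) (hxA : A x j ≠ 0) : ∃ r, x < r ∧ r ≤ u ∧ A r (j + 1) ≠ 0 := by
  by_contra hcon
  push Not at hcon
  have hns : ¬ ColSurvPlus A j x := fun h => by have := humin x h; omega
  have hns2 : ∃ w, x < w ∧ (A x j - 1) + ∑ i ∈ Finset.Ioo x w, A i j <
      ∑ i ∈ Finset.Ioc x w, A i (j + 1) := by
    by_contra h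
    push Not at h
    exact hns ⟨Nat.pos_of_ne_zero hxA, fun w hw => h w hw⟩
  obtain ⟨w, hw, hlt⟩ := hns2
  rcases le_or_gt w u with hwu | hwu
  · have : ∑ i ∈ Finset.Ioc x w, A i (j + 1) = 0 := Finset.sum_eq_zero (fun i hi => by
      rw [Finset.mem_Ioc] at hi; exact hcon i hi.1 (by omega))
    omega
  · have h1 : ∑ i ∈ Finset.Ioc x w, A i (j + 1) = ∑ i ∈ Finset.Ioc u w, A i (j + 1) := by
      symm
      apply Finset.sum_subset
      · intro i hi
        rw [Finset.mem_Ioc] at hi ⊢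
        omega
      · intro i hi hi2
        rw [Finset.mem_Ioc] at hi hi2
        exact hcon i hi.1 (by omega)
    have h2 := hu.2 w hwu
    have h3 : A u j + ∑ i ∈ Finset.Ioo u w, A i j ≤ ∑ i ∈ Finset.Ioo x w, A i j := by
      rw [← Finset.sum_insert (f := fun i => A i j) (by simp)]
      apply Finset.sum_le_sum_of_subset
      intro i hi
      rw [Finset.mem_insert, Finset.mem_Ioo] at hi
      rw [Finset.mem_Ioo]
      omega
    have := hu.1
    omega

theorem best_aux {m n l : ℕ} {A : Mat} {e : ℤ → Cell} {D : Cell → ℤ}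
    (eA : ∀ i, e i ∈ supp A) (eD : ∀ i, D (e i) = i)
    (per : ∀ c ∈ supp A, D (Tk m n 1 c) = D c + l)
    (lt : ∀ c ∈ supp A, ∀ p ∈ supp A, NW c p → D c < D p)
    (hsw : ∀ C : Set Cell, IsChannel m n A C → swGe A (Set.range e) C) :
    ∀ f, IsStreamEnum m n f l → (∀ i, f i ∈ supp A) → (∀ i, D (f i) = i) →
    ∀ i, neLe (e i) (f i) := by
  intro f sf fA fD i
  have hC : IsChannel m n A (Set.range f) := by
    refine ⟨l, ⟨f, sf, rfl⟩, ?_, ?_⟩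
    · rintro _ ⟨i, rfl⟩; exact fA i
    · rintro S l' ⟨g, sg, rfl⟩ hS
      exact flow_le lt per sg (fun i => hS ⟨i, rfl⟩)
  obtain ⟨-, _, ⟨i', rfl⟩, h1⟩ := hsw _ hC ⟨i, rfl⟩
  rcases Ctx.same_level lt (eA i) (fA i) (by rw [eD, fD]) with h | h
  · exact h
  · obtain ⟨a1, a2⟩ := h
    obtain ⟨b1, b2⟩ := h1
    rcases lt_trichotomy i i' with hi | rfl | hi
    · have := (st_lt sf hi).1
      omega
    · exact ⟨b1, b2⟩
    · have := (st_lt sf hi).2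
      omega

theorem sw_of_ctx {m n l : ℕ} {A B : Mat} {u j : ℤ} {e : ℤ → Cell} {D : Cell → ℤ}
    (X : Ctx m n A B u j e l D) : IsSWNumbering m n B D := by
  obtain ⟨e', se, eB, eD, best, mem⟩ := X.main_sw
  have per : ∀ c ∈ supp B, D (Tk m n 1 c) = D c + l := fun c _ => by rw [X.perD]; ring
  refine ⟨e', ⟨⟨l, se⟩, ⟨l, ⟨e', se, rfl⟩, ?_, ?_⟩, ?_⟩, ?_⟩
  · rintro _ ⟨i, rfl⟩; exact eB i
  · rintro S l' ⟨g, sg, rfl⟩ hS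
    exact flow_le X.ltB per sg (fun i => hS ⟨i, rfl⟩)
  · rintro C ⟨l', ⟨f, sf, rfl⟩, hS, hmax⟩
    have fB : ∀ i, f i ∈ supp B := fun i => hS ⟨i, rfl⟩
    have hl1 : l' ≤ l := flow_le X.ltB per sf fB
    have hl2 : l ≤ l' := hmax _ l ⟨e', se, rfl⟩ (by rintro _ ⟨i, rfl⟩; exact eB i)
    obtain rfl : l' = l := le_antisymm hl1 hl2
    obtain ⟨κ, hκ⟩ := st_level X.ltB per sf fB
    rintro _ ⟨i, rfl⟩
    refine ⟨eB i, f (i + -κ), ⟨_, rfl⟩, ?_⟩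
    exact best (fun i => f (i + -κ)) (st_shift sf _) (fun i => fB _)
      (fun i => by rw [hκ]; ring) i
  · intro c hc
    exact ⟨mem c hc, fun v hv => Ctx.chain_le X.ltB eD hv⟩

theorem build_ctx {m n : ℕ} (hm : 0 < m) (hn : 2 ≤ n) {A : Mat} (hA : IsGAP m n A) {j u : ℤ}
    (hu : ColSurvPlus A j u) (humin : ∀ u' : ℤ, ColSurvPlus A j u' → u ≤ u')
    {dA : Cell → ℤ} (hdA : IsSWNumbering m n A dA) :
    ∃ e l D, Ctx m n A (ftApply m n u j A) u j e l D ∧ ∀ c ∈ supp A, D c = dA c := by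
  obtain ⟨e, ⟨⟨l, se⟩, ⟨_, -, hsub, -⟩, hsw⟩, hnum⟩ := hdA
  have hn0 : 0 < n := by omega
  have eA : ∀ i, e i ∈ supp A := fun i => hsub ⟨i, rfl⟩
  have perA := supp_Tk (gap_Tk hA)
  obtain ⟨per, lt, ex, eD⟩ := numbering_data se perA eA hnum
  obtain ⟨D, hD, perD, ltD, exD⟩ := extend_data hm hn0 se perA eA per lt ex
  have kn1 : ∀ k : ℤ, k * (n:ℤ) ≠ 1 := by
    intro k h
    have : (n:ℤ) ∣ 1 := ⟨k, by linarith⟩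
    have := Int.eq_one_of_dvd_one (by positivity) this
    omega
  refine ⟨e, l, D, ⟨hm, hn, se, eA, fun i => by rw [hD _ (eA i), eD], perA,
    supp_Tk (ft_per (gap_Tk hA) u j), perD, ltD, exD, ?_, ?_, ?_, ?_, ?_, ?_, ?_, ?_⟩, hD⟩
  · exact best_aux eA (fun i => by rw [hD _ (eA i), eD]) (fun c _ => by rw [perD]; ring)
      (fun c hc p _ h => ltD c hc p h) hsw
  · intro c hc
    rw [hD c hc]; exact (hnum c hc).1
  · intro c hc
    simp only [supp, Set.mem_ofPred_eq, ftApply] at hc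
    split_ifs at hc with h1 h2
    · left
      simp only [supp, Set.mem_ofPred_eq]
      omega
    · right
      obtain ⟨k, h3, h4⟩ := h2
      exact ⟨k, Prod.ext h3 h4⟩
    · left; exact hc
  · have c1 : ¬ ∃ k : ℤ, u = u + k * (m:ℤ) ∧ j + 1 = j + k * (n:ℤ) := by
      rintro ⟨k, -, h⟩
      exact kn1 k (by linarith)
    have c2 : ∃ k : ℤ, u = u + k * (m:ℤ) ∧ j + 1 = j + 1 + k * (n:ℤ) := ⟨0, by simp, by simp⟩
    simp only [supp, Set.mem_ofPred_eq, ftApply]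
    rw [if_neg c1, if_pos c2]
    omega
  · intro c hc hcB
    simp only [supp, Set.mem_ofPred_eq, ftApply] at hc hcB
    split_ifs at hcB with h1 h2
    · obtain ⟨k, h3, h4⟩ := h1
      exact ⟨k, Prod.ext h3 h4⟩
    · omega
    · exact absurd hc hcB
  · have := hu.1
    simp only [supp, Set.mem_ofPred_eq]
    omega
  · intro hB x hx hxA
    have c1 : ∃ k : ℤ, u = u + k * (m:ℤ) ∧ j = j + k * (n:ℤ) := ⟨0, by simp, by simp⟩
    simp only [supp, Set.mem_ofPred_eq, ftApply] at hB
    rw [if_pos c1] at hB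
    exact sig1_aux hu (by omega) hx hxA
  · intro x hx hxA
    exact sig2_aux hu humin hx hxA

/-- Let `n ≥ 2`, `A ∈ M̂_{m×n}` nonzero, and suppose
`Ã := f̃^t_j A ≠ 0`, i.e. `Ã = A - Ê_{u,j} + Ê_{u,j+1}` for the selected row
`u`. Let `dA` be the southwest channel numbering of `A` and `s = dA(u, j)`.
Then the southwest channel numbering of `Ã` is the unique proper numbering
`d⁻` on `Ã` with `d⁻ = dA` on `supp A ∩ supp Ã` and `d⁻(u, j+1) = dA(u, j)`
if `u` is the minimal row index `i` with `(i, j) ∈ z_s`, and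
`d⁻(u, j+1) = dA(u, j) + 1` otherwise. -/
theorem sw_numbering_after_ft (m n : ℕ) (hm : 0 < m) (hn : 2 ≤ n)
    (A : Mat) (hA : IsGAP m n A) (hA0 : A ≠ 0) (j u : ℤ)
    (hj0 : 0 ≤ j) (hj1 : j ≤ (n : ℤ) - 1)
    (hu : ColSurvPlus A j u) (humin : ∀ u' : ℤ, ColSurvPlus A j u' → u ≤ u')
    (dA : Cell → ℤ) (hdA : IsSWNumbering m n A dA) :
    ∃ dm : Cell → ℤ,
      IsProper (ftApply m n u j A) dm ∧
      (∀ c ∈ supp A ∩ supp (ftApply m n u j A), dm c = dA c) ∧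
      ((∃ z : ℤ → Cell, ZigZagAt A dA (dA (u, j)) z ∧
          ((u, j) : Cell) ∈ Set.range z ∧
          ∀ i : ℤ, ((i, j) : Cell) ∈ Set.range z → u ≤ i) →
        dm (u, j + 1) = dA (u, j)) ∧
      ((¬ ∃ z : ℤ → Cell, ZigZagAt A dA (dA (u, j)) z ∧
          ((u, j) : Cell) ∈ Set.range z ∧
          ∀ i : ℤ, ((i, j) : Cell) ∈ Set.range z → u ≤ i) →
        dm (u, j + 1) = dA (u, j) + 1) ∧
      IsSWNumbering m n (ftApply m n u j A) dm ∧
      ∀ d' : Cell → ℤ,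
        IsProper (ftApply m n u j A) d' →
        (∀ c ∈ supp A ∩ supp (ftApply m n u j A), d' c = dA c) →
        ((∃ z : ℤ → Cell, ZigZagAt A dA (dA (u, j)) z ∧
            ((u, j) : Cell) ∈ Set.range z ∧
            ∀ i : ℤ, ((i, j) : Cell) ∈ Set.range z → u ≤ i) →
          d' (u, j + 1) = dA (u, j)) →
        ((¬ ∃ z : ℤ → Cell, ZigZagAt A dA (dA (u, j)) z ∧
            ((u, j) : Cell) ∈ Set.range z ∧
            ∀ i : ℤ, ((i, j) : Cell) ∈ Set.range z → u ≤ i) →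
          d' (u, j + 1) = dA (u, j) + 1) →
        ∀ c ∈ supp (ftApply m n u j A), d' c = dm c := by
  obtain ⟨e, l, D, X, hD⟩ := build_ctx hm hn hA hu humin hdA
  have hfin : (levelSet A dA (dA (u, j))).Finite := by
    refine level_finite (m := m) (n := n) (l := l) (by omega) X.se.1 hA.2 X.perA ?_ _
    intro k c hc
    rw [← hD c hc, ← hD _ ((X.perA k c).2 hc), X.perD]
  have hz := zz_iff hfin (u := u) (j := j) ⟨X.uA, rfl⟩
  have hT : (∀ c ∈ levelSet A dA (dA (u, j)), c.2 ≤ j → u ≤ c.1) ↔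
      ∀ c ∈ supp A, D c = D (u, j) → c.2 ≤ j → u ≤ c.1 := by
    constructor
    · intro h c hc h1 h2
      exact h c ⟨hc, by rw [← hD c hc, h1, hD _ X.uA]⟩ h2
    · rintro h c ⟨hc, h1⟩ h2
      exact h c hc (by rw [hD c hc, h1, hD _ X.uA]) h2
  rw [hT] at hz
  obtain ⟨v1, v2⟩ := X.new_val
  rw [← hz, hD _ X.uA] at v1 v2
  refine ⟨D, X.properB, fun c hc => hD c hc.1, v1, v2, sw_of_ctx X, ?_⟩
  intro d' hp hold w1 w2
  refine X.uniq hp (fun c h1 h2 => by rw [hold c ⟨h1, h2⟩, hD c h1]) ?_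
  by_cases h : ∃ z : ℤ → Cell, ZigZagAt A dA (dA (u, j)) z ∧
      ((u, j) : Cell) ∈ Set.range z ∧ ∀ i : ℤ, ((i, j) : Cell) ∈ Set.range z → u ≤ i
  · rw [w1 h, v1 h]
  · rw [w2 h, v2 h]

end AffineRSK
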